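/- A priori error estimate for filtered quantities: there exists a constant C > 0, independent of N, h, ν, δ, T and the data, such that the following holds. Let u be a smooth periodic solution of the viscous Burgers equation with viscosity ν ≥ 0 and smooth 1-periodic initial data u₀; let u_h solve the mass-lumped Galerkin scheme with linear artificial viscosity on [0,T] with initial nodal values u_h(·,0) = π_h u₀; set U₀ := max_j |u_j(0)|, D₀ := (1/2)·( sup_x u₀'(x) + max_i d_i(0) ) and assume D₀ ≥ 0; let δ > 0, let ũ and ũ_h be the differential filters (width δ) of u(·,T) and u_h(·,T), and set ẽ := ũ − ũ_h. Assume the linearized dual adjoint problem with coefficient a := (u + u_h)/2, viscosity ν and terminal data ẽ admits a smooth solution. Then ⟦ẽ⟧_δ ≤ C·exp(D₀·T)·(h/δ²)^{1/2}·[ ( h^{1/2} + U₀^{1/2}·T^{1/2} )·‖u₀‖_{L²(0,1)} + ( T·U₀ + h^{1/2}·ν^{1/2} )·‖u₀'‖_{L²(0,1)} ]. In particular the bound is independent of the regularity of the exact solution and of the Reynolds number. -/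

import Mathlib

open Set

/-- The continuous, 1-periodic, piecewise linear function on the uniform mesh
`xᵢ = i/N`, `i ∈ ZMod N`, with nodal values `v`: on the element
`[xᵢ, xᵢ₊₁]` it equals `vᵢ + (x − xᵢ)·(vᵢ₊₁ − vᵢ)/h`, `h = 1/N`. -/
noncomputable def plin (N : ℕ) (v : ZMod N → ℝ) (x : ℝ) : ℝ :=
  v ((⌊x * (N : ℝ)⌋ : ℤ) : ZMod N)
    + (x * (N : ℝ) - (⌊x * (N : ℝ)⌋ : ℤ)) *
        (v (((⌊x * (N : ℝ)⌋ : ℤ) : ZMod N) + 1) - v ((⌊x * (N : ℝ)⌋ : ℤ) : ZMod N))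

/-- The piecewise constant space derivative of `plin N v`: on the element
`[xᵢ, xᵢ₊₁]` it equals `(vᵢ₊₁ − vᵢ)/h = N (vᵢ₊₁ − vᵢ)`. -/
noncomputable def pconst (N : ℕ) (v : ZMod N → ℝ) (x : ℝ) : ℝ :=
  (N : ℝ) * (v (((⌊x * (N : ℝ)⌋ : ℤ) : ZMod N) + 1) - v ((⌊x * (N : ℝ)⌋ : ℤ) : ZMod N))


/-- piecewise function -/
noncomputable def pw (N : ℕ) (F : ZMod N → ℝ → ℝ) (x : ℝ) : ℝ :=
  F ((⌊x * (N : ℝ)⌋ : ℤ) : ZMod N) (x * (N : ℝ) - (⌊x * (N : ℝ)⌋ : ℤ))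

lemma pw_plin (N : ℕ) (v : ZMod N → ℝ) :
    plin N v = pw N (fun i s => v i + s * (v (i + 1) - v i)) := rfl

lemma pw_pconst (N : ℕ) (v : ZMod N → ℝ) :
    pconst N v = pw N (fun i _ => (N : ℝ) * (v (i + 1) - v i)) := rfl

lemma pw_eq_Ico (N : ℕ) (F : ZMod N → ℝ → ℝ) (k : ℤ) (x : ℝ)
    (h1 : (k : ℝ) ≤ x * N) (h2 : x * N < k + 1) :
    pw N F x = F (k : ZMod N) (x * N - k) := by
  have : ⌊x * (N : ℝ)⌋ = k := Int.floor_eq_iff.mpr ⟨h1, h2⟩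
  simp only [pw, this]

lemma pw_eq_Icc (N : ℕ) (F : ZMod N → ℝ → ℝ) (hm : ∀ i, F i 1 = F (i + 1) 0) (k : ℤ) (x : ℝ)
    (h1 : (k : ℝ) ≤ x * N) (h2 : x * N ≤ k + 1) :
    pw N F x = F (k : ZMod N) (x * N - k) := by
  rcases h2.lt_or_eq with h | h
  · exact pw_eq_Ico N F k x h1 h
  · rw [pw_eq_Ico N F (k + 1) x (by push_cast; linarith) (by push_cast; linarith)]
    have e1 : x * N - ((k + 1 : ℤ) : ℝ) = 0 := by push_cast; linarith
    have e2 : x * N - (k : ℝ) = 1 := by linarith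
    rw [e1, e2, hm]; push_cast; rfl

lemma pw_periodic (N : ℕ) (F : ZMod N → ℝ → ℝ) (x : ℝ) : pw N F (x + 1) = pw N F x := by
  have : ⌊(x + 1) * (N : ℝ)⌋ = ⌊x * (N : ℝ)⌋ + (N : ℤ) := by
    rw [add_mul, one_mul]; exact_mod_cast Int.floor_add_natCast (x * (N:ℝ)) N
  simp only [pw, this]
  push_cast
  congr 1
  · simp
  · ring

lemma pw_continuous (N : ℕ) [NeZero N] (F : ZMod N → ℝ → ℝ) (hF : ∀ i, Continuous (F i))
    (hm : ∀ i, F i 1 = F (i + 1) 0) : Continuous (pw N F) := by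
  have hN : (0 : ℝ) < N := by exact_mod_cast Nat.pos_of_ne_zero (NeZero.ne N)
  have c1 : Continuous (fun x : ℝ => x * (N : ℝ)) := by fun_prop
  have key : ∀ k : ℤ, ContinuousOn (pw N F) {x | (k : ℝ) ≤ x * N ∧ x * N ≤ k + 1} := by
    intro k
    have : ContinuousOn (fun x : ℝ => F (k : ZMod N) (x * N - k))
        {x | (k : ℝ) ≤ x * N ∧ x * N ≤ k + 1} := by
      exact ((hF _).comp (by fun_prop)).continuousOn
    exact this.congr (fun x hx => pw_eq_Icc N F hm k x hx.1 hx.2)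
  have cl : ∀ k : ℤ, IsClosed {x : ℝ | (k : ℝ) ≤ x * N ∧ x * N ≤ k + 1} := by
    intro k
    exact isClosed_Icc.preimage c1
  rw [continuous_iff_continuousAt]
  intro x
  set k := ⌊x * (N : ℝ)⌋ with hk
  have h1 : (k : ℝ) ≤ x * N := Int.floor_le _
  have h2 : x * N < k + 1 := Int.lt_floor_add_one _
  have hu := (key (k - 1)).union_of_isClosed (key k) (cl _) (cl _)
  refine hu.continuousAt ?_
  have hopen : IsOpen {y : ℝ | (k : ℝ) - 1 < y * N ∧ y * N < k + 1} :=
    isOpen_Ioo.preimage c1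
  refine Filter.mem_of_superset (hopen.mem_nhds ⟨by linarith, h2⟩) ?_
  rintro y ⟨hy1, hy2⟩
  rcases le_total (y * N) k with h | h
  · left; constructor <;> push_cast <;> linarith
  · right; exact ⟨h, hy2.le⟩

lemma pw_hasDeriv (N : ℕ) [NeZero N] (F F' : ZMod N → ℝ → ℝ)
    (hF : ∀ i s, HasDerivAt (F i) (F' i s) s) (x : ℝ) :
    HasDerivWithinAt (pw N F) (pw N (fun i s => N * F' i s) x) (Ioi x) x := by
  have hN : (0 : ℝ) < N := by exact_mod_cast Nat.pos_of_ne_zero (NeZero.ne N)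
  set k := ⌊x * (N : ℝ)⌋ with hk
  have h1 : (k : ℝ) ≤ x * N := Int.floor_le _
  have h2 : x * N < k + 1 := Int.lt_floor_add_one _
  have e : pw N (fun i s => N * F' i s) x = F' (k : ZMod N) (x * N - k) * N := by
    rw [pw_eq_Ico N _ k x h1 h2]; ring
  rw [e]
  have hd : HasDerivAt (fun y : ℝ => F (k : ZMod N) (y * N - k))
      (F' (k : ZMod N) (x * N - k) * N) x := by
    have h3 : HasDerivAt (fun y : ℝ => y * (N : ℝ) - k) (N : ℝ) x := by
      simpa using ((hasDerivAt_id x).mul_const (N : ℝ)).sub_const (k : ℝ)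
    exact (hF _ _).comp x h3
  refine hd.hasDerivWithinAt.congr_of_eventuallyEq ?_ (pw_eq_Ico N F k x h1 h2)
  have hopen : IsOpen {y : ℝ | y * N < k + 1} := isOpen_lt (by fun_prop) continuous_const
  filter_upwards [self_mem_nhdsWithin, mem_nhdsWithin_of_mem_nhds (hopen.mem_nhds h2)] with y hy1 hy2
  exact pw_eq_Ico N F k y (h1.trans (by have : x < y := hy1; nlinarith)) hy2

lemma sum_range_zmod (N : ℕ) [NeZero N] (a : ZMod N → ℝ) :
    ∑ k ∈ Finset.range N, a (k : ZMod N) = ∑ i, a i := by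
  refine Finset.sum_bij' (fun k _ => (k : ZMod N)) (fun i _ => i.val) ?_ ?_ ?_ ?_ ?_
  · intros; simp
  · intro i _; simpa using ZMod.val_lt i
  · intro k hk; exact ZMod.val_cast_of_lt (by simpa using hk)
  · intro i _; simp
  · intros; rfl

lemma pw_piece (N : ℕ) [NeZero N] (F : ZMod N → ℝ → ℝ) (hF : ∀ i, Continuous (F i)) (k : ℕ) :
    IntervalIntegrable (pw N F) MeasureTheory.volume ((k : ℝ) / N) (((k + 1 : ℕ) : ℝ) / N) ∧
    ∫ x in ((k : ℝ) / N)..(((k + 1 : ℕ) : ℝ) / N), pw N F x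
      = (1 / N) * ∫ s in (0 : ℝ)..1, F (k : ZMod N) s := by
  have hN : (0 : ℝ) < N := by exact_mod_cast Nat.pos_of_ne_zero (NeZero.ne N)
  have hle : (k : ℝ) / N ≤ ((k + 1 : ℕ) : ℝ) / N := by
    push_cast; gcongr; linarith
  have hc : Continuous (fun x : ℝ => F (k : ZMod N) (x * N - k)) := (hF _).comp (by fun_prop)
  have heq : ∀ x ∈ Ioo ((k : ℝ) / N) (((k + 1 : ℕ) : ℝ) / N),
      pw N F x = F (k : ZMod N) (x * N - k) := by
    intro x hx
    have h1 := (div_lt_iff₀ hN).mp hx.1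
    have h2 := (lt_div_iff₀ hN).mp hx.2
    have := pw_eq_Ico N F (k : ℤ) x (by push_cast; exact h1.le) (by push_cast at h2 ⊢; exact h2)
    simpa using this
  constructor
  · refine (hc.intervalIntegrable _ _).congr_uIoo ?_
    rw [uIoo_of_le hle]
    intro x hx; exact (heq x hx).symm
  · rw [intervalIntegral.integral_congr_uIoo (g := fun x : ℝ => F (k : ZMod N) (x * N - k))
      (by rw [uIoo_of_le hle]; exact heq)]
    have := intervalIntegral.integral_comp_mul_sub (a := (k : ℝ) / N) (b := ((k + 1 : ℕ) : ℝ) / N)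
      (fun s => F (k : ZMod N) s) hN.ne' (k : ℝ)
    simp only [mul_comm _ (N : ℝ)]
    rw [this]
    have e1 : (N : ℝ) * ((k : ℝ) / N) - k = 0 := by field_simp; ring
    have e2 : (N : ℝ) * (((k + 1 : ℕ) : ℝ) / N) - k = 1 := by push_cast; field_simp; ring
    rw [e1, e2]; simp

lemma pw_integrable (N : ℕ) [NeZero N] (F : ZMod N → ℝ → ℝ) (hF : ∀ i, Continuous (F i)) :
    IntervalIntegrable (pw N F) MeasureTheory.volume 0 1 := by
  have hN : (N : ℝ) ≠ 0 := by exact_mod_cast NeZero.ne N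
  have := IntervalIntegrable.trans_iterate (f := pw N F) (μ := MeasureTheory.volume)
    (a := fun k : ℕ => (k : ℝ) / N) (n := N) (fun k _ => (pw_piece N F hF k).1)
  simpa [hN] using this

lemma pw_integral (N : ℕ) [NeZero N] (F : ZMod N → ℝ → ℝ) (hF : ∀ i, Continuous (F i)) :
    ∫ x in (0 : ℝ)..1, pw N F x = (1 / N) * ∑ i, ∫ s in (0 : ℝ)..1, F i s := by
  have hN : (N : ℝ) ≠ 0 := by exact_mod_cast NeZero.ne N
  have := intervalIntegral.sum_integral_adjacent_intervals (f := pw N F)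
    (μ := MeasureTheory.volume)
    (a := fun k : ℕ => (k : ℝ) / N) (n := N) (fun k _ => (pw_piece N F hF k).1)
  simp only [CharP.cast_eq_zero, zero_div, div_self hN] at this
  rw [← this, ← sum_range_zmod, Finset.mul_sum]
  exact Finset.sum_congr rfl (fun k _ => (pw_piece N F hF k).2)

lemma plin_continuous (N : ℕ) [NeZero N] (v : ZMod N → ℝ) : Continuous (plin N v) := by
  rw [pw_plin]
  exact pw_continuous N _ (fun i => by fun_prop) (fun i => by ring)

lemma plin_periodic (N : ℕ) (v : ZMod N → ℝ) (x : ℝ) : plin N v (x + 1) = plin N v x := by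
  rw [pw_plin]; exact pw_periodic _ _ _

lemma plin_hasDeriv (N : ℕ) [NeZero N] (v : ZMod N → ℝ) (x : ℝ) :
    HasDerivWithinAt (plin N v) (pconst N v x) (Ioi x) x := by
  rw [pw_plin, pw_pconst]
  exact pw_hasDeriv N _ (fun i _ => v (i + 1) - v i)
    (fun i s => by simpa using ((hasDerivAt_id s).mul_const (v (i + 1) - v i)).const_add (v i)) x

lemma plin_abs_le (N : ℕ) (v : ZMod N → ℝ) (B : ℝ) (hB : ∀ i, |v i| ≤ B) (x : ℝ) :
    |plin N v x| ≤ B := by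
  unfold plin
  set k := ⌊x * (N : ℝ)⌋ with hk
  have h1 : (k : ℝ) ≤ x * N := Int.floor_le _
  have h2 : x * N < k + 1 := Int.lt_floor_add_one _
  have a1 := abs_le.mp (hB (k : ZMod N))
  have a2 := abs_le.mp (hB ((k : ZMod N) + 1))
  rw [abs_le]; constructor <;> nlinarith

lemma sum_shift (N : ℕ) [NeZero N] (f : ZMod N → ℝ) : ∑ i, f (i + 1) = ∑ i, f i :=
  Equiv.sum_comp (Equiv.addRight (1 : ZMod N)) f

lemma sum_shift' (N : ℕ) [NeZero N] (f : ZMod N → ℝ) : ∑ i, f (i - 1) = ∑ i, f i :=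
  Equiv.sum_comp (Equiv.subRight (1 : ZMod N)) f


lemma max_principle {K : Type*} [TopologicalSpace K] [CompactSpace K] (T L : ℝ)
    (g g' : K → ℝ → ℝ)
    (hcont : ContinuousOn (fun p : K × ℝ => g p.1 p.2) (univ ×ˢ Icc 0 T))
    (hd : ∀ k, ∀ t ∈ Ioc (0 : ℝ) T, HasDerivWithinAt (g k) (g' k t) (Icc 0 T) t)
    (h0 : ∀ k, g k 0 ≤ 0)
    (hmax : ∀ k, ∀ t ∈ Ioc (0 : ℝ) T, 0 < g k t → (∀ j, g j t ≤ g k t) → g' k t ≤ L * g k t) :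
    ∀ k, ∀ t ∈ Icc (0 : ℝ) T, g k t ≤ 0 := by
  by_contra! hcon
  obtain ⟨k0, t0, ht0, hpos⟩ := hcon
  have hF : ContinuousOn (fun p : K × ℝ => Real.exp (-(L + 1) * p.2) * g p.1 p.2)
      (univ ×ˢ Icc 0 T) :=
    ContinuousOn.mul (by fun_prop) hcont
  obtain ⟨⟨k, t⟩, hkt, hm⟩ := (isCompact_univ.prod isCompact_Icc).exists_isMaxOn
    ⟨(k0, t0), mem_univ _, ht0⟩ hF
  have hm' : ∀ j, ∀ s ∈ Icc (0 : ℝ) T,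
      Real.exp (-(L + 1) * s) * g j s ≤ Real.exp (-(L + 1) * t) * g k t :=
    fun j s hs => hm (a := (j, s)) ⟨mem_univ _, hs⟩
  have htI : t ∈ Icc (0 : ℝ) T := hkt.2
  have hgpos : 0 < g k t := by
    have h1 := hm' k0 t0 ht0
    have h2 : 0 < Real.exp (-(L + 1) * t0) * g k0 t0 := mul_pos (Real.exp_pos _) hpos
    exact pos_of_mul_pos_right (h2.trans_le h1) (Real.exp_pos _).le
  have htpos : 0 < t := by
    rcases htI.1.lt_or_eq with h | h
    · exact h
    · exfalso; rw [← h] at hgpos; linarith [h0 k]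
  have hkm : ∀ j, g j t ≤ g k t := fun j =>
    le_of_mul_le_mul_left (hm' j t htI) (Real.exp_pos _)
  have hder := hmax k t ⟨htpos, htI.2⟩ hgpos hkm
  have hFd : HasDerivWithinAt (fun s => Real.exp (-(L + 1) * s) * g k s)
      (Real.exp (-(L + 1) * t) * (-(L + 1)) * g k t + Real.exp (-(L + 1) * t) * g' k t)
      (Iio t) t := by
    have e1 : HasDerivAt (fun s => Real.exp (-(L + 1) * s))
        (Real.exp (-(L + 1) * t) * (-(L + 1))) t := by
      have := ((hasDerivAt_id t).const_mul (-(L + 1))).exp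
      simpa using this
    have e2 : HasDerivWithinAt (g k) (g' k t) (Iio t) t := by
      refine (hd k t ⟨htpos, htI.2⟩).mono_of_mem_nhdsWithin ?_
      have : Ioo 0 t ∈ nhdsWithin t (Iio t) := Ioo_mem_nhdsLT htpos
      exact Filter.mem_of_superset this (fun s hs => ⟨hs.1.le, hs.2.le.trans htI.2⟩)
    exact e1.hasDerivWithinAt.mul e2
  have hsl := (hasDerivWithinAt_iff_tendsto_slope' (by simp)).mp hFd
  have hge : 0 ≤ Real.exp (-(L + 1) * t) * (-(L + 1)) * g k t
      + Real.exp (-(L + 1) * t) * g' k t := by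
    refine ge_of_tendsto hsl ?_
    have : Ioo 0 t ∈ nhdsWithin t (Iio t) := Ioo_mem_nhdsLT htpos
    filter_upwards [this] with s hs
    rw [slope_def_field]
    exact div_nonneg_of_nonpos (by linarith [hm' k s ⟨hs.1.le, hs.2.le.trans htI.2⟩])
      (by linarith [hs.2])
  have hE := Real.exp_pos (-(L + 1) * t)
  have : Real.exp (-(L + 1) * t) * (-(L + 1)) * g k t + Real.exp (-(L + 1) * t) * g' k t
      = Real.exp (-(L + 1) * t) * (g' k t - (L + 1) * g k t) := by ring
  rw [this] at hge
  have h3 := nonneg_of_mul_nonneg_right hge hE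
  linarith

lemma max_principle_fin {K : Type*} [Finite K] (T L : ℝ)
    (g g' : K → ℝ → ℝ)
    (hd : ∀ k, ∀ t ∈ Icc (0 : ℝ) T, HasDerivWithinAt (g k) (g' k t) (Icc 0 T) t)
    (h0 : ∀ k, g k 0 ≤ 0)
    (hmax : ∀ k, ∀ t ∈ Ioc (0 : ℝ) T, 0 < g k t → (∀ j, g j t ≤ g k t) → g' k t ≤ L * g k t) :
    ∀ k, ∀ t ∈ Icc (0 : ℝ) T, g k t ≤ 0 := by
  let _ : TopologicalSpace K := ⊥
  have : DiscreteTopology K := ⟨rfl⟩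
  refine max_principle T L g g' ?_ (fun k t ht => hd k t ⟨ht.1.le, ht.2⟩) h0 hmax
  rw [continuousOn_prod_of_discrete_left]
  intro k t ht
  have := (hd k t ht.2).continuousWithinAt
  have e : {b : ℝ | (k, b) ∈ (univ : Set K) ×ˢ Icc (0 : ℝ) T} = Icc 0 T := by
    ext b; simp
  rw [e]
  exact this

lemma exists_bound (N : ℕ) [NeZero N] (T : ℝ) (w : ℝ → ZMod N → ℝ)
    (hw : ∀ i, ContinuousOn (fun s => w s i) (Icc 0 T)) :
    ∃ B, 0 ≤ B ∧ ∀ i, ∀ t ∈ Icc (0 : ℝ) T, |w t i| ≤ B := by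
  have : ∀ i, ∃ B, ∀ t ∈ Icc (0 : ℝ) T, |w t i| ≤ B := fun i => by
    obtain ⟨B, hB⟩ := isCompact_Icc.exists_bound_of_continuousOn (hw i)
    exact ⟨B, fun t ht => hB t ht⟩
  choose B hB using this
  refine ⟨∑ i, |B i|, Finset.sum_nonneg (fun _ _ => abs_nonneg _), fun i t ht => ?_⟩
  calc |w t i| ≤ B i := hB i t ht
    _ ≤ |B i| := le_abs_self _
    _ ≤ _ := Finset.single_le_sum (f := fun i => |B i|) (fun _ _ => abs_nonneg _)
        (Finset.mem_univ i)

lemma alg_w (x y M V U B : ℝ) (hx : |x| ≤ M) (hy : |y| ≤ M) (hMB : M ≤ B) (hU : U ≤ M)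
    (hV : U / 2 ≤ V) :
    -(1 / 6) * (x ^ 2 + M * x - M * y - y ^ 2) + V * (x - 2 * M + y) ≤ 2 * B * (M - U) := by
  obtain ⟨x1, x2⟩ := abs_le.mp hx
  obtain ⟨y1, y2⟩ := abs_le.mp hy
  have hM : 0 ≤ M := (abs_nonneg _).trans hx
  have a1 : 0 ≤ (M - y) * (M + y) := mul_nonneg (by linarith) (by linarith)
  have a2 : 0 ≤ (V - U / 2) * (2 * M - x - y) := mul_nonneg (by linarith) (by linarith)
  have a3 : 0 ≤ (M - U) * (2 * M + x + y) := mul_nonneg (by linarith) (by linarith)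
  have a4 : 0 ≤ (M - U) * (B - M) := mul_nonneg (by linarith) (by linarith)
  have a5 : 0 ≤ (M - y) * M := mul_nonneg (by linarith) (by linarith)
  nlinarith [sq_nonneg (M - x)]

lemma w_bound (N : ℕ) [NeZero N] (T U V : ℝ) (w w' : ℝ → ZMod N → ℝ)
    (hU0 : ∀ i, |w 0 i| ≤ U) (hV : U / 2 ≤ V)
    (hd : ∀ i, ∀ t ∈ Icc (0 : ℝ) T,
        HasDerivWithinAt (fun s => w s i) (w' t i) (Icc (0 : ℝ) T) t)
    (hode : ∀ i, ∀ t ∈ Icc (0 : ℝ) T, w' t i = N * (-(1 / 6) * (w t (i + 1) ^ 2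
      + w t i * w t (i + 1) - w t i * w t (i - 1) - w t (i - 1) ^ 2)
      + V * (w t (i + 1) - 2 * w t i + w t (i - 1)))) :
    ∀ i, ∀ t ∈ Icc (0 : ℝ) T, |w t i| ≤ U := by
  have hN : (0 : ℝ) < N := by exact_mod_cast Nat.pos_of_ne_zero (NeZero.ne N)
  obtain ⟨B, hB0, hB⟩ := exists_bound N T w (fun i t ht => (hd i t ht).continuousWithinAt)
  have hU : 0 ≤ U := (abs_nonneg _).trans (hU0 0)
  have key := max_principle_fin (K := ZMod N × Bool) T (N * (2 * B))
    (fun k t => (if k.2 then w t k.1 else -w t k.1) - U)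
    (fun k t => if k.2 then w' t k.1 else -w' t k.1) ?_ ?_ ?_
  · intro i t ht
    have h1 := key (i, true) t ht
    have h2 := key (i, false) t ht
    simp at h1 h2
    rw [abs_le]; constructor <;> linarith
  · rintro ⟨i, b⟩ t ht
    cases b
    · simpa using ((hd i t ht).neg).sub_const U
    · simpa using ((hd i t ht)).sub_const U
  · rintro ⟨i, b⟩
    have := abs_le.mp (hU0 i)
    cases b <;> simp <;> linarith
  · rintro ⟨i, b⟩ t ht hpos hmax
    have htI : t ∈ Icc (0 : ℝ) T := ⟨ht.1.le, ht.2⟩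
    have hb := abs_le.mp (hB i t htI)
    cases b
    · simp at hpos hmax
      simp only [Bool.false_eq_true, if_false]
      have hM : ∀ j, |-w t j| ≤ -w t i := fun j => by
        rw [abs_le]; constructor <;> linarith [(hmax j).1, (hmax j).2]
      have := alg_w (-w t (i - 1)) (-w t (i + 1)) (-w t i) V U B (hM _) (hM _) (by linarith)
        (by linarith) hV
      rw [hode i t htI, mul_assoc, ← mul_neg]
      refine mul_le_mul_of_nonneg_left ?_ hN.le
      refine le_trans (le_of_eq ?_) this
      ring
    · simp at hpos hmax
      simp only [if_true]
      have hM : ∀ j, |w t j| ≤ w t i := fun j => by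
        rw [abs_le]; constructor <;> linarith [(hmax j).1, (hmax j).2]
      have := alg_w (w t (i + 1)) (w t (i - 1)) (w t i) V U B (hM _) (hM _) (by linarith)
        (by linarith) hV
      rw [hode i t htI, mul_assoc]
      exact mul_le_mul_of_nonneg_left this hN.le

lemma alg_d (a b c e U V : ℝ) (hb : |b| ≤ U) (hc : |c| ≤ U)
    (hV : U / 2 ≤ V) (hp : e - c ≤ c - b) (hq : b - a ≤ c - b) :
    (-(1 / 6) * (e ^ 2 + c * e - c * b - b ^ 2) + V * (e - 2 * c + b))
     - (-(1 / 6) * (c ^ 2 + b * c - b * a - a ^ 2) + V * (c - 2 * b + a)) ≤ 0 := by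
  obtain ⟨b1, b2⟩ := abs_le.mp hb
  obtain ⟨c1, c2⟩ := abs_le.mp hc
  obtain ⟨p, rfl⟩ : ∃ p, e = 2 * c - b - p := ⟨2 * c - b - e, by ring⟩
  obtain ⟨q, rfl⟩ : ∃ q, a = 2 * b - c + q := ⟨a - 2 * b + c, by ring⟩
  have hp0 : 0 ≤ p := by linarith
  have hq0 : 0 ≤ q := by linarith
  have a1 : 0 ≤ (V - U / 2) * (p + q) := mul_nonneg (by linarith) (by linarith)
  have a2 : 0 ≤ p * (U - c) := mul_nonneg hp0 (by linarith)
  have a3 : 0 ≤ q * (U + b) := mul_nonneg hq0 (by linarith)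
  nlinarith [sq_nonneg (p - (c - b)), sq_nonneg (q - (c - b)), sq_nonneg (c - b)]

lemma d_bound (N : ℕ) [NeZero N] (T U V D : ℝ) (w w' : ℝ → ZMod N → ℝ)
    (hU : ∀ i, ∀ t ∈ Icc (0 : ℝ) T, |w t i| ≤ U) (hV : U / 2 ≤ V)
    (hd0 : ∀ i, N * (w 0 (i + 1) - w 0 i) ≤ D)
    (hd : ∀ i, ∀ t ∈ Icc (0 : ℝ) T,
        HasDerivWithinAt (fun s => w s i) (w' t i) (Icc (0 : ℝ) T) t)
    (hode : ∀ i, ∀ t ∈ Icc (0 : ℝ) T, w' t i = N * (-(1 / 6) * (w t (i + 1) ^ 2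
      + w t i * w t (i + 1) - w t i * w t (i - 1) - w t (i - 1) ^ 2)
      + V * (w t (i + 1) - 2 * w t i + w t (i - 1)))) :
    ∀ i, ∀ t ∈ Icc (0 : ℝ) T, N * (w t (i + 1) - w t i) ≤ D := by
  have hN : (0 : ℝ) < N := by exact_mod_cast Nat.pos_of_ne_zero (NeZero.ne N)
  have key := max_principle_fin (K := ZMod N) T 0
    (fun i t => N * (w t (i + 1) - w t i) - D)
    (fun i t => N * (w' t (i + 1) - w' t i)) ?_ ?_ ?_
  · intro i t ht
    linarith [key i t ht]
  · intro i t ht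
    exact (((hd (i + 1) t ht).sub (hd i t ht)).const_mul (N : ℝ)).sub_const D
  · intro i; linarith [hd0 i]
  · intro i t ht hpos hmax
    have htI : t ∈ Icc (0 : ℝ) T := ⟨ht.1.le, ht.2⟩
    have hm : ∀ j, w t (j + 1) - w t j ≤ w t (i + 1) - w t i := fun j =>
      le_of_mul_le_mul_left (by linarith [hmax j]) hN
    have h1 := hm (i + 1)
    have h2 := hm (i - 1)
    rw [sub_add_cancel] at h2
    have := alg_d (w t (i - 1)) (w t i) (w t (i + 1)) (w t (i + 1 + 1)) U V (hU _ t htI) (hU _ t htI)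
      hV h1 h2
    rw [hode i t htI, hode (i + 1) t htI, add_sub_cancel_right, ← mul_sub, zero_mul]
    exact mul_nonpos_of_nonneg_of_nonpos hN.le (mul_nonpos_of_nonneg_of_nonpos hN.le this)

lemma second_deriv_nonpos (f f' : ℝ → ℝ) (c x : ℝ) (hf : ∀ y, HasDerivAt f (f' y) y)
    (hf' : HasDerivAt f' c x) (hm : IsLocalMax f x) : c ≤ 0 := by
  by_contra! hc
  have e : deriv f = f' := funext fun y => (hf y).deriv
  have h0 : deriv f x = 0 := hm.deriv_eq_zero
  have hmin := isLocalMin_of_deriv_deriv_pos (f := f) (x₀ := x) (by rw [e, hf'.deriv]; exact hc) h0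
    (hf x).continuousAt
  have hconst : f =ᶠ[nhds x] fun _ => f x := by
    filter_upwards [hm, hmin] with y h1 h2
    exact le_antisymm h1 h2
  have : deriv (deriv f) x = 0 := by
    rw [(hconst.deriv).deriv_eq]; simp
  rw [e, hf'.deriv] at this
  linarith

lemma ux_bound (T ν M : ℝ) (hν : 0 ≤ ν) (hM : 0 ≤ M) (u ux uxx ut : ℝ → ℝ → ℝ)
    (hper : ∀ x t, u (x + 1) t = u x t)
    (hcu : Continuous fun p : ℝ × ℝ => u p.1 p.2)
    (hx : ∀ x t, HasDerivAt (fun y => u y t) (ux x t) x)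
    (hxx : ∀ x t, HasDerivAt (fun y => ux y t) (uxx x t) x)
    (ht : ∀ x, ∀ t ∈ Icc (0 : ℝ) T,
        HasDerivWithinAt (fun s => u x s) (ut x t) (Icc (0 : ℝ) T) t)
    (hpde : ∀ x, ∀ t ∈ Ioc (0 : ℝ) T,
        ut x t + u x t * ux x t - ν * uxx x t = 0)
    (h0 : ∀ x, ux x 0 ≤ M) :
    ∀ x, ∀ t ∈ Icc (0 : ℝ) T, ux x t ≤ M := by
  have hperz : ∀ t (x : ℝ), u (Int.fract x) t = u x t := by
    intro t x
    have hp : Function.Periodic (fun y => u y t) 1 := fun y => hper y t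
    have := hp.sub_zsmul_eq (x := x) ⌊x⌋
    rw [Int.fract]
    simpa only [zsmul_eq_mul, mul_one] using this
  have key := max_principle (K := Icc (0 : ℝ) 1 × Icc (0 : ℝ) 1) T 0
    (fun k t => u (k.1 + k.2) t - u k.1 t - M * k.2)
    (fun k t => ut (k.1 + k.2) t - ut k.1 t) ?_ ?_ ?_ ?_
  · have key2 : ∀ y, ∀ r ∈ Icc (0 : ℝ) 1, ∀ t ∈ Icc (0 : ℝ) T, u (y + r) t - u y t ≤ M * r := by
      intro y r hr t ht
      have := key (⟨Int.fract y, Int.fract_nonneg y, (Int.fract_lt_one y).le⟩, ⟨r, hr⟩) t ht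
      simp only at this
      rw [hperz t y] at this
      have e : u (Int.fract y + r) t = u (y + r) t := by
        rw [← hperz t (Int.fract y + r), ← hperz t (y + r)]
        congr 1
        rw [Int.fract_eq_fract]
        exact ⟨-⌊y⌋, by rw [Int.fract]; push_cast; ring⟩
      rw [e] at this
      linarith
    intro x t htI
    have hsl := (hasDerivWithinAt_iff_tendsto_slope' (s := Ioi x) (by simp)).mp
      (hx x t).hasDerivWithinAt
    refine le_of_tendsto hsl ?_
    have : Ioo x (x + 1) ∈ nhdsWithin x (Ioi x) := Ioo_mem_nhdsGT (by linarith)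
    filter_upwards [this] with y hy
    rw [slope_def_field, div_le_iff₀ (by linarith [hy.1])]
    have := key2 x (y - x) ⟨by linarith [hy.1], by linarith [hy.2]⟩ t htI
    simpa using this
  · refine Continuous.continuousOn ?_
    have a1 : Continuous (fun p : (Icc (0 : ℝ) 1 × Icc (0 : ℝ) 1) × ℝ =>
        u ((p.1.1 : ℝ) + p.1.2) p.2) :=
      hcu.comp (f := fun p : (Icc (0 : ℝ) 1 × Icc (0 : ℝ) 1) × ℝ =>
        (((p.1.1 : ℝ) + p.1.2), p.2)) (by fun_prop)
    have a2 : Continuous (fun p : (Icc (0 : ℝ) 1 × Icc (0 : ℝ) 1) × ℝ =>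
        u (p.1.1 : ℝ) p.2) :=
      hcu.comp (f := fun p : (Icc (0 : ℝ) 1 × Icc (0 : ℝ) 1) × ℝ =>
        ((p.1.1 : ℝ), p.2)) (by fun_prop)
    exact (a1.sub a2).sub (by fun_prop)
  · intro k t htI
    exact ((ht _ t ⟨htI.1.le, htI.2⟩).sub (ht _ t ⟨htI.1.le, htI.2⟩)).sub_const _
  · rintro ⟨⟨y, hy⟩, ⟨r, hr⟩⟩
    simp only
    have : ∀ z, u (z + r) 0 - M * (z + r) ≤ u z 0 - M * z := by
      have ha : Antitone (fun z => u z 0 - M * z) := by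
        have hd : ∀ z, HasDerivAt (fun z => u z 0 - M * z) (ux z 0 - M) z := fun z => by
          exact (hx z 0).sub (hasDerivAt_const_mul M)
        refine antitone_of_deriv_nonpos (fun z => (hd z).differentiableAt) (fun z => ?_)
        rw [(hd z).deriv]; linarith [h0 z]
      intro z; exact ha (by linarith [hr.1])
    linarith [this y]
  · rintro ⟨⟨y, hy⟩, ⟨r, hr⟩⟩ t htI hpos hmax
    simp only at hpos hmax ⊢
    have hr0 : 0 < r := by
      rcases hr.1.lt_or_eq with h | h
      · exact h
      · exfalso; rw [← h] at hpos; simp at hpos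
    have hr1 : r < 1 := by
      rcases hr.2.lt_or_eq with h | h
      · exact h
      · exfalso; rw [h, hper] at hpos; linarith
    have hmax' : ∀ z, ∀ s ∈ Icc (0 : ℝ) 1,
        u (z + s) t - u z t - M * s ≤ u (y + r) t - u y t - M * r := by
      intro z s hs
      have := hmax (⟨Int.fract z, Int.fract_nonneg z, (Int.fract_lt_one z).le⟩, ⟨s, hs⟩)
      simp only at this
      have e : u (Int.fract z + s) t = u (z + s) t := by
        rw [← hperz t (Int.fract z + s), ← hperz t (z + s)]
        congr 1
        rw [Int.fract_eq_fract]
        exact ⟨-⌊z⌋, by rw [Int.fract]; push_cast; ring⟩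
      rw [hperz, e] at this
      exact this
    have hdX : ∀ z, HasDerivAt (fun z => u z t - M * z) (ux z t - M) z := fun z => by
      exact (hx z t).sub (hasDerivAt_const_mul M)
    have hdY : ∀ z, HasDerivAt (fun z => M * z - u z t) (M - ux z t) z := fun z => by
      exact (hasDerivAt_const_mul M).sub (hx z t)
    have mX : IsLocalMax (fun z => u z t - M * z) (y + r) := by
      have : Ioo y (y + 1) ∈ nhds (y + r) := Ioo_mem_nhds (by linarith) (by linarith)
      filter_upwards [this] with z hz
      have := hmax' y (z - y) ⟨by linarith [hz.1], by linarith [hz.2]⟩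
      rw [add_sub_cancel] at this
      linarith
    have mY : IsLocalMax (fun z => M * z - u z t) y := by
      have : Ioo (y + r - 1) (y + r) ∈ nhds y := Ioo_mem_nhds (by linarith) (by linarith)
      filter_upwards [this] with z hz
      have := hmax' z (y + r - z) ⟨by linarith [hz.2], by linarith [hz.1]⟩
      rw [add_sub_cancel] at this
      linarith
    have x1 : ux (y + r) t - M = 0 := by
      have := mX.deriv_eq_zero
      rwa [(hdX _).deriv] at this
    have y1 : M - ux y t = 0 := by
      have := mY.deriv_eq_zero
      rwa [(hdY _).deriv] at this
    have x2 : uxx (y + r) t ≤ 0 :=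
      second_deriv_nonpos _ _ _ _ hdX ((hxx (y + r) t).sub_const M) mX
    have y2 : -uxx y t ≤ 0 :=
      second_deriv_nonpos _ _ _ _ hdY ((hxx y t).const_sub M) mY
    have p1 := hpde (y + r) t htI
    have p2 := hpde y t htI
    have e1 : ux (y + r) t = M := by linarith
    have e2 : ux y t = M := by linarith
    rw [e1] at p1
    rw [e2] at p2
    have q1 : 0 ≤ M * (u (y + r) t - u y t) := by
      have : 0 ≤ M * r := mul_nonneg hM hr.1
      exact mul_nonneg hM (by linarith)
    have q2 : ν * uxx (y + r) t ≤ 0 := mul_nonpos_of_nonneg_of_nonpos hν x2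
    have q3 : 0 ≤ ν * uxx y t := mul_nonneg hν (by linarith)
    nlinarith


lemma int_periodic_zero (Z z : ℝ → ℝ) (hZ : Continuous Z)
    (hd : ∀ x, HasDerivWithinAt Z (z x) (Ioi x) x)
    (hz : IntervalIntegrable z MeasureTheory.volume 0 1) (h1 : Z 1 = Z 0) :
    ∫ x in (0 : ℝ)..1, z x = 0 := by
  rw [intervalIntegral.integral_eq_sub_of_hasDeriv_right hZ.continuousOn (fun x _ => hd x) hz, h1,
    sub_self]

/-- element fluxes -/
noncomputable def GN (N : ℕ) (m : ℝ) (v : ZMod N → ℝ) (i : ZMod N) : ℝ :=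
  (v (i + 1) ^ 2 + v i * v (i + 1) + v i ^ 2) / 6 - m * (N * (v (i + 1) - v i))

/-- reconstructed flux -/
noncomputable def GF (N : ℕ) (m : ℝ) (v : ZMod N → ℝ) (i : ZMod N) (s : ℝ) : ℝ :=
  GN N m v i + (1 / 2) * (-(1 - s) ^ 2 * (GN N m v i - GN N m v (i - 1))
    + s ^ 2 * (GN N m v (i + 1) - GN N m v i))

/-- primitive of the viscous lumping error -/
noncomputable def HF (N : ℕ) (v : ZMod N → ℝ) (i : ZMod N) (s : ℝ) : ℝ :=
  -(1 / 6) * ((1 - s) ^ 3 * ((v (i + 1) - v i) - (v i - v (i - 1)))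
    + s ^ 3 * ((v (i + 1 + 1) - v (i + 1)) - (v (i + 1) - v i)))

/-- its derivative -/
noncomputable def HxF (N : ℕ) (v : ZMod N → ℝ) (i : ZMod N) (s : ℝ) : ℝ :=
  (1 / 2) * ((1 - s) ^ 2 * ((v (i + 1) - v i) - (v i - v (i - 1)))
    - s ^ 2 * ((v (i + 1 + 1) - v (i + 1)) - (v (i + 1) - v i)))

/-- remaining residual -/
noncomputable def RF (N : ℕ) (ν m : ℝ) (v : ZMod N → ℝ) (i : ZMod N) (s : ℝ) : ℝ :=
  GF N m v i s - (v i + s * (v (i + 1) - v i)) ^ 2 / 2 + ν * (N * (v (i + 1) - v i))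
    - ν * (N * HxF N v i s)

lemma HF_cont (N : ℕ) [NeZero N] (v : ZMod N → ℝ) : Continuous (pw N (HF N v)) := by
  refine pw_continuous N _ (fun i => by unfold HF; fun_prop) (fun i => ?_)
  simp only [HF, add_sub_cancel_right]; ring

lemma HF_deriv (N : ℕ) [NeZero N] (v : ZMod N → ℝ) (x : ℝ) :
    HasDerivWithinAt (pw N (HF N v)) (pw N (fun i s => N * HxF N v i s) x) (Ioi x) x := by
  refine pw_hasDeriv N _ _ (fun i s => ?_) x
  unfold HF HxF
  have h1 : HasDerivAt (fun s : ℝ => (1 - s) ^ 3) (3 * (1 - s) ^ 2 * (-1)) s := by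
    simpa using ((hasDerivAt_id s).const_sub 1).fun_pow 3
  have h2 : HasDerivAt (fun s : ℝ => s ^ 3) (3 * s ^ 2) s := by
    simpa using (hasDerivAt_id s).fun_pow 3
  have h3 := ((h1.mul_const ((v (i + 1) - v i) - (v i - v (i - 1)))).add
    (h2.mul_const ((v (i + 1 + 1) - v (i + 1)) - (v (i + 1) - v i)))).const_mul (-(1 / 6))
  refine h3.congr_deriv ?_
  ring

lemma GF_cont (N : ℕ) [NeZero N] (m : ℝ) (v : ZMod N → ℝ) : Continuous (pw N (GF N m v)) := by
  refine pw_continuous N _ (fun i => by unfold GF; fun_prop) (fun i => ?_)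
  simp only [GF, add_sub_cancel_right]; ring

lemma GF_deriv (N : ℕ) [NeZero N] (m : ℝ) (v v' : ZMod N → ℝ)
    (hv : ∀ i, v' i = -N * (GN N m v i - GN N m v (i - 1))) (x : ℝ) :
    HasDerivWithinAt (pw N (GF N m v)) (-plin N v' x) (Ioi x) x := by
  have := pw_hasDeriv N (GF N m v) (fun i s => (1 - s) * (GN N m v i - GN N m v (i - 1))
    + s * (GN N m v (i + 1) - GN N m v i)) (fun i s => ?_) x
  · refine this.congr_deriv ?_
    rw [pw_plin]
    simp only [pw, hv, add_sub_cancel_right]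
    ring
  · unfold GF
    have h1 : HasDerivAt (fun s : ℝ => -(1 - s) ^ 2) (-(2 * (1 - s) * (-1))) s := by
      have := (((hasDerivAt_id s).const_sub 1).fun_pow 2).fun_neg
      simpa using this
    have h2 : HasDerivAt (fun s : ℝ => s ^ 2) (2 * s) s := by
      simpa using (hasDerivAt_id s).fun_pow 2
    have h3 := (((h1.mul_const (GN N m v i - GN N m v (i - 1))).add
      (h2.mul_const (GN N m v (i + 1) - GN N m v i))).const_mul (1 / 2)).const_add (GN N m v i)
    refine h3.congr_deriv ?_
    ring

lemma RF_pw (N : ℕ) (ν m : ℝ) (v : ZMod N → ℝ) (x : ℝ) :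
    pw N (RF N ν m v) x = pw N (GF N m v) x - (plin N v x) ^ 2 / 2 + ν * pconst N v x
      - ν * pw N (fun i s => N * HxF N v i s) x := by
  rw [pw_plin, pw_pconst]; rfl

lemma energy_static (N : ℕ) [NeZero N] (ν m T D : ℝ) (hν : 0 ≤ ν) (hT : 0 < T)
    (v : ZMod N → ℝ) (u ux E : ℝ → ℝ) (hux : Continuous ux)
    (hu : ∀ x, HasDerivAt u (ux x) x) (hup : u 1 = u 0)
    (hE : ∀ x, HasDerivAt E (u x - plin N v x) x) (hEp : E 1 = E 0)
    (hD : ∀ x i, (ux x + N * (v (i + 1) - v i)) / 2 ≤ D) :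
    ∫ x in (0 : ℝ)..1, 2 * E x * (-u x ^ 2 / 2 + ν * ux x + pw N (GF N m v) x)
      ≤ (D + 1 / T) * (∫ x in (0 : ℝ)..1, E x ^ 2)
        + (ν / 2) * (∫ x in (0 : ℝ)..1, pw N (HF N v) x ^ 2)
        + T * (∫ x in (0 : ℝ)..1, pw N (RF N ν m v) x ^ 2) := by
  have cu : Continuous u := continuous_iff_continuousAt.mpr fun x => (hu x).continuousAt
  have cE : Continuous E := continuous_iff_continuousAt.mpr fun x => (hE x).continuousAt
  have cp := plin_continuous N v
  have cH := HF_cont N v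
  have cG := GF_cont N m v
  have ipc : IntervalIntegrable (pconst N v) MeasureTheory.volume 0 1 := by
    rw [pw_pconst]; exact pw_integrable N _ (fun i => continuous_const)
  have iHx : IntervalIntegrable (pw N (fun i s => N * HxF N v i s)) MeasureTheory.volume 0 1 :=
    pw_integrable N _ (fun i => by unfold HxF; fun_prop)
  have iR : IntervalIntegrable (fun x => pw N (RF N ν m v) x ^ 2) MeasureTheory.volume 0 1 := by
    exact pw_integrable N (fun i s => RF N ν m v i s ^ 2)
      (fun i => by unfold RF GF HxF; fun_prop)
  -- the periodic function
  set Hx := pw N (fun i s => N * HxF N v i s) with hHx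
  set H := pw N (HF N v) with hH
  set p := plin N v with hp
  set pc := pconst N v with hpc
  let Z : ℝ → ℝ := fun x => -(1 / 4) * ((u x + p x) * E x ^ 2) + ν * ((u x - p x + H x) * E x)
  let z : ℝ → ℝ := fun x => -(1 / 4) * ((ux x + pc x) * E x ^ 2
      + (u x + p x) * (2 * E x * (u x - p x)))
    + ν * ((ux x - pc x + Hx x) * E x + (u x - p x + H x) * (u x - p x))
  have hZd : ∀ x, HasDerivWithinAt Z (z x) (Ioi x) x := by
    intro x
    have a1 := (hu x).hasDerivWithinAt (s := Ioi x)
    have a2 := plin_hasDeriv N v x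
    have a3 := (hE x).hasDerivWithinAt (s := Ioi x)
    have a4 := HF_deriv N v x
    have b1 : HasDerivWithinAt (fun x => E x ^ 2) (2 * E x * (u x - p x)) (Ioi x) x := by
      have := a3.pow 2
      refine this.congr_deriv ?_
      simp
    exact (((a1.add a2).mul b1).const_mul (-(1 / 4))).add
      ((((a1.sub a2).add a4).mul a3).const_mul ν)
  have hZc : Continuous Z := by fun_prop
  have hzi : IntervalIntegrable z MeasureTheory.volume 0 1 := by
    have i1 : IntervalIntegrable (fun x => (ux x + pc x) * E x ^ 2) MeasureTheory.volume 0 1 :=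
      ((hux.intervalIntegrable 0 1).add ipc).mul_continuousOn (by fun_prop)
    have i2 : IntervalIntegrable (fun x => (ux x - pc x + Hx x) * E x) MeasureTheory.volume 0 1 :=
      (((hux.intervalIntegrable 0 1).sub ipc).add iHx).mul_continuousOn (by fun_prop)
    have i3 : IntervalIntegrable (fun x => (u x + p x) * (2 * E x * (u x - p x)))
      MeasureTheory.volume 0 1 := Continuous.intervalIntegrable (by fun_prop) _ _
    have i4 : IntervalIntegrable (fun x => (u x - p x + H x) * (u x - p x))
      MeasureTheory.volume 0 1 := Continuous.intervalIntegrable (by fun_prop) _ _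
    exact ((i1.add i3).const_mul _).add ((i2.add i4).const_mul _)
  have p1 : p 1 = p 0 := by simpa using plin_periodic N v 0
  have H1 : H 1 = H 0 := by simpa using pw_periodic N (HF N v) 0
  have hz0 := int_periodic_zero Z z hZc hZd hzi (by simp only [Z, p1, H1, hup, hEp])
  have iE2 : IntervalIntegrable (fun x => E x ^ 2) MeasureTheory.volume 0 1 :=
    Continuous.intervalIntegrable (by fun_prop) _ _
  have iH2 : IntervalIntegrable (fun x => H x ^ 2) MeasureTheory.volume 0 1 :=
    Continuous.intervalIntegrable (by fun_prop) _ _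
  have hmono : ∫ x in (0 : ℝ)..1, 2 * E x * (-u x ^ 2 / 2 + ν * ux x + pw N (GF N m v) x)
      ≤ ∫ x in (0 : ℝ)..1, (2 * z x + (D + 1 / T) * E x ^ 2 + (ν / 2) * H x ^ 2
        + T * pw N (RF N ν m v) x ^ 2) := by
    refine intervalIntegral.integral_mono_on zero_le_one
      (Continuous.intervalIntegrable (by fun_prop) _ _)
      ((((hzi.const_mul 2).add (iE2.const_mul _)).add (iH2.const_mul _)).add (iR.const_mul _)) ?_
    intro x _
    have hR := RF_pw N ν m v x
    rw [← hp, ← hpc, ← hHx] at hR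
    set R := pw N (RF N ν m v) x
    have hG : pw N (GF N m v) x = R + (p x) ^ 2 / 2 - ν * pc x + ν * Hx x := by linarith
    rw [hG]
    have hDx : (ux x + pc x) / 2 ≤ D := hD x _
    have k1 : (ux x + pc x) / 2 * E x ^ 2 ≤ D * E x ^ 2 :=
      mul_le_mul_of_nonneg_right hDx (sq_nonneg _)
    have k2 : 2 * E x * R ≤ 1 / T * E x ^ 2 + T * R ^ 2 := by
      have : 0 ≤ 1 / T * (E x - T * R) ^ 2 := by positivity
      have e : 1 / T * (E x - T * R) ^ 2 = 1 / T * E x ^ 2 - 2 * E x * R + T * R ^ 2 := by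
        field_simp; ring
      linarith
    have k3 : 0 ≤ ν * (2 * (u x - p x) + H x) ^ 2 := mul_nonneg hν (sq_nonneg _)
    simp only [z]
    nlinarith
  refine hmono.trans (le_of_eq ?_)
  rw [intervalIntegral.integral_add (((hzi.const_mul 2).add (iE2.const_mul _)).add
      (iH2.const_mul _)) (iR.const_mul _),
    intervalIntegral.integral_add ((hzi.const_mul 2).add (iE2.const_mul _)) (iH2.const_mul _),
    intervalIntegral.integral_add (hzi.const_mul 2) (iE2.const_mul _)]
  simp only [intervalIntegral.integral_const_mul]
  rw [hz0]; ring

lemma pw_sq_bound (N : ℕ) [NeZero N] (F : ZMod N → ℝ → ℝ) (hF : ∀ i, Continuous (F i))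
    (g : ZMod N → ℝ) (c : ℝ)
    (hb : ∀ i, ∀ s ∈ Icc (0 : ℝ) 1, F i s ^ 2 ≤ c * (g (i - 1) ^ 2 + g i ^ 2 + g (i + 1) ^ 2)) :
    ∫ x in (0 : ℝ)..1, pw N F x ^ 2 ≤ 3 * c * ((1 / N) * ∑ i, g i ^ 2) := by
  have h1 : ∫ x in (0 : ℝ)..1, pw N F x ^ 2 = (1 / N) * ∑ i, ∫ s in (0 : ℝ)..1, F i s ^ 2 :=
    pw_integral N (fun i s => F i s ^ 2) (fun i => by have := hF i; fun_prop)
  rw [h1]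
  have h2 : ∑ i, ∫ s in (0 : ℝ)..1, F i s ^ 2
      ≤ ∑ i, c * (g (i - 1) ^ 2 + g i ^ 2 + g (i + 1) ^ 2) := by
    refine Finset.sum_le_sum (fun i _ => ?_)
    have := intervalIntegral.integral_mono_on (μ := MeasureTheory.volume) zero_le_one
      (f := fun s => F i s ^ 2)
      (g := fun _ => c * (g (i - 1) ^ 2 + g i ^ 2 + g (i + 1) ^ 2))
      (Continuous.intervalIntegrable (by have := hF i; fun_prop) _ _)
      (Continuous.intervalIntegrable (by fun_prop) _ _) (hb i)
    simpa using this
  rw [← Finset.mul_sum, Finset.sum_add_distrib, Finset.sum_add_distrib,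
    sum_shift' N (fun i => g i ^ 2), sum_shift N (fun i => g i ^ 2)] at h2
  have hN : (0 : ℝ) ≤ 1 / N := by positivity
  calc _ ≤ (1 / (N : ℝ)) * (c * (∑ i, g i ^ 2 + ∑ i, g i ^ 2 + ∑ i, g i ^ 2)) :=
        mul_le_mul_of_nonneg_left h2 hN
    _ = _ := by ring

lemma HF_bound (N : ℕ) [NeZero N] (v : ZMod N → ℝ) :
    ∫ x in (0 : ℝ)..1, pw N (HF N v) x ^ 2 ≤ (1 / N) * ∑ i, (v (i + 1) - v i) ^ 2 := by
  have := pw_sq_bound N (HF N v) (fun i => by unfold HF; fun_prop) (fun i => v (i + 1) - v i)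
    (1 / 3) ?_
  · refine this.trans (le_of_eq (by ring))
  · rintro i s ⟨hs0, hs1⟩
    unfold HF
    simp only [sub_add_cancel]
    set a := v i - v (i - 1)
    set b := v (i + 1) - v i
    set c := v (i + 1 + 1) - v (i + 1)
    have e1 : 0 ≤ (1 - s) ^ 3 := by have : 0 ≤ 1 - s := by linarith
                                    positivity
    have e2 : (1 - s) ^ 3 ≤ 1 := pow_le_one₀ (by linarith) (by linarith)
    have e3 : 0 ≤ s ^ 3 := by positivity
    have e4 : s ^ 3 ≤ 1 := pow_le_one₀ (by linarith) (by linarith)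
    set P := (1 - s) ^ 3
    set Q := s ^ 3
    have f1 : (P * (b - a)) ^ 2 ≤ (b - a) ^ 2 := by
      rw [mul_pow]; exact mul_le_of_le_one_left (sq_nonneg _) (by nlinarith)
    have f2 : (Q * (c - b)) ^ 2 ≤ (c - b) ^ 2 := by
      rw [mul_pow]; exact mul_le_of_le_one_left (sq_nonneg _) (by nlinarith)
    nlinarith [sq_nonneg (P * (b - a) - Q * (c - b)), sq_nonneg (a + b), sq_nonneg (b + c)]

lemma alg_R (a b c e U μ s : ℝ) (ha : |a| ≤ U) (hb : |b| ≤ U) (hc : |c| ≤ U) (he : |e| ≤ U)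
    (hμ0 : 0 ≤ μ) (hμ : μ ≤ U / 2) (hs0 : 0 ≤ s) (hs1 : s ≤ 1) :
    |((c ^ 2 + b * c + b ^ 2) / 6 - (b + s * (c - b)) ^ 2 / 2) - μ * (c - b)
      + (1 / 2) * (-(1 - s) ^ 2 * (((c ^ 2 + b * c + b ^ 2) / 6 - (b ^ 2 + a * b + a ^ 2) / 6)
          - μ * ((c - b) - (b - a)))
        + s ^ 2 * (((e ^ 2 + c * e + c ^ 2) / 6 - (c ^ 2 + b * c + b ^ 2) / 6)
          - μ * ((e - c) - (c - b))))|
      ≤ 4 * U * (|b - a| + |c - b| + |e - c|) := by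
  have hU : 0 ≤ U := (abs_nonneg _).trans ha
  obtain ⟨a1, a2⟩ := abs_le.mp ha
  obtain ⟨b1, b2⟩ := abs_le.mp hb
  obtain ⟨c1, c2⟩ := abs_le.mp hc
  obtain ⟨e1, e2⟩ := abs_le.mp he
  have A : |(c ^ 2 + b * c + b ^ 2) / 6 - (b + s * (c - b)) ^ 2 / 2| ≤ 2 * U * |c - b| := by
    have : (c ^ 2 + b * c + b ^ 2) / 6 - (b + s * (c - b)) ^ 2 / 2
      = (b * (1 / 2 - s) + (c - b) * (1 / 6 - s ^ 2 / 2)) * (c - b) := by ring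
    rw [this, abs_mul]
    refine mul_le_mul_of_nonneg_right ?_ (abs_nonneg _)
    have x1 : |b * (1 / 2 - s)| ≤ U * (1 / 2) := by
      rw [abs_mul]
      exact mul_le_mul hb (by rw [abs_le]; constructor <;> linarith) (abs_nonneg _) hU
    have x2 : |(c - b) * (1 / 6 - s ^ 2 / 2)| ≤ (2 * U) * (1 / 3) := by
      rw [abs_mul]
      exact mul_le_mul (by rw [abs_le]; constructor <;> linarith)
        (by rw [abs_le]; constructor <;> nlinarith) (abs_nonneg _) (by linarith)
    refine (abs_add_le _ _).trans ?_
    linarith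
  have B : ∀ x y z : ℝ, |x| ≤ U → |y| ≤ U → |z| ≤ U →
      |((z ^ 2 + y * z + y ^ 2) / 6 - (y ^ 2 + x * y + x ^ 2) / 6) - μ * ((z - y) - (y - x))|
        ≤ U * (|z - y| + |y - x|) := by
    intro x y z hx hy hz
    obtain ⟨x1, x2⟩ := abs_le.mp hx
    obtain ⟨y1, y2⟩ := abs_le.mp hy
    obtain ⟨z1, z2⟩ := abs_le.mp hz
    have : ((z ^ 2 + y * z + y ^ 2) / 6 - (y ^ 2 + x * y + x ^ 2) / 6) - μ * ((z - y) - (y - x))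
      = ((x + y + z) / 6 - μ) * (z - y) + ((x + y + z) / 6 + μ) * (y - x) := by ring
    rw [this]
    refine (abs_add_le _ _).trans ?_
    rw [abs_mul, abs_mul, mul_add]
    refine add_le_add ?_ ?_
    · refine mul_le_mul_of_nonneg_right ?_ (abs_nonneg _)
      rw [abs_le]; constructor <;> linarith
    · refine mul_le_mul_of_nonneg_right ?_ (abs_nonneg _)
      rw [abs_le]; constructor <;> linarith
  have B1 := B a b c ha hb hc
  have B2 := B b c e hb hc he
  set X1 := ((c ^ 2 + b * c + b ^ 2) / 6 - (b ^ 2 + a * b + a ^ 2) / 6) - μ * ((c - b) - (b - a))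
  set X2 := ((e ^ 2 + c * e + c ^ 2) / 6 - (c ^ 2 + b * c + b ^ 2) / 6) - μ * ((e - c) - (c - b))
  set X0 := (c ^ 2 + b * c + b ^ 2) / 6 - (b + s * (c - b)) ^ 2 / 2
  have M1 : |μ * (c - b)| ≤ U / 2 * |c - b| := by
    rw [abs_mul, abs_of_nonneg hμ0]
    exact mul_le_mul_of_nonneg_right hμ (abs_nonneg _)
  have C1 : |(1 - s) ^ 2 * X1| ≤ |X1| := by
    rw [abs_mul]
    refine mul_le_of_le_one_left (abs_nonneg _) ?_
    rw [abs_le]; constructor <;> nlinarith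
  have C2 : |s ^ 2 * X2| ≤ |X2| := by
    rw [abs_mul]
    refine mul_le_of_le_one_left (abs_nonneg _) ?_
    rw [abs_le]; constructor <;> nlinarith
  have p1 := mul_nonneg hU (abs_nonneg (b - a))
  have p2 := mul_nonneg hU (abs_nonneg (c - b))
  have p3 := mul_nonneg hU (abs_nonneg (e - c))
  obtain ⟨A1, A2⟩ := abs_le.mp A
  obtain ⟨m1, m2⟩ := abs_le.mp M1
  obtain ⟨q1, q2⟩ := abs_le.mp (C1.trans B1)
  obtain ⟨q3, q4⟩ := abs_le.mp (C2.trans B2)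
  rw [abs_le]
  constructor <;> linarith

lemma RF_bound (N : ℕ) [NeZero N] (ν m U : ℝ) (v : ZMod N → ℝ) (hv : ∀ i, |v i| ≤ U)
    (h0 : 0 ≤ (m - ν) * N) (h1 : (m - ν) * N ≤ U / 2) :
    ∫ x in (0 : ℝ)..1, pw N (RF N ν m v) x ^ 2
      ≤ 144 * U ^ 2 * ((1 / N) * ∑ i, (v (i + 1) - v i) ^ 2) := by
  have := pw_sq_bound N (RF N ν m v) (fun i => by unfold RF GF HxF; fun_prop)
    (fun i => v (i + 1) - v i) (48 * U ^ 2) ?_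
  · refine this.trans (le_of_eq (by ring))
  · rintro i s ⟨hs0, hs1⟩
    have key := alg_R (v (i - 1)) (v i) (v (i + 1)) (v (i + 1 + 1)) U ((m - ν) * N) s
      (hv _) (hv _) (hv _) (hv _) h0 h1 hs0 hs1
    simp only [sub_add_cancel]
    have e : RF N ν m v i s = ((v (i + 1) ^ 2 + v i * v (i + 1) + v i ^ 2) / 6
       - (v i + s * (v (i + 1) - v i)) ^ 2 / 2) - ((m - ν) * N) * (v (i + 1) - v i)
      + (1 / 2) * (-(1 - s) ^ 2 * (((v (i + 1) ^ 2 + v i * v (i + 1) + v i ^ 2) / 6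
          - (v i ^ 2 + v (i - 1) * v i + v (i - 1) ^ 2) / 6)
          - ((m - ν) * N) * ((v (i + 1) - v i) - (v i - v (i - 1))))
        + s ^ 2 * (((v (i + 1 + 1) ^ 2 + v (i + 1) * v (i + 1 + 1) + v (i + 1) ^ 2) / 6
          - (v (i + 1) ^ 2 + v i * v (i + 1) + v i ^ 2) / 6)
          - ((m - ν) * N) * ((v (i + 1 + 1) - v (i + 1)) - (v (i + 1) - v i)))) := by
      simp only [RF, GF, GN, HxF, sub_add_cancel]; ring
    rw [← e] at key
    have k2 : RF N ν m v i s ^ 2 ≤ (4 * U * (|v i - v (i - 1)| + |v (i + 1) - v i|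
      + |v (i + 1 + 1) - v (i + 1)|)) ^ 2 := by
      rw [← sq_abs]
      exact pow_le_pow_left₀ (abs_nonneg _) key 2
    refine k2.trans ?_
    rw [← sq_abs (v i - v (i - 1)), ← sq_abs (v (i + 1) - v i), ← sq_abs (v (i + 1 + 1) - v (i + 1))]
    set x := |v i - v (i - 1)|
    set y := |v (i + 1) - v i|
    set z := |v (i + 1 + 1) - v (i + 1)|
    have : (x + y + z) ^ 2 ≤ 3 * (x ^ 2 + y ^ 2 + z ^ 2) := by
      nlinarith [sq_nonneg (x - y), sq_nonneg (y - z), sq_nonneg (x - z)]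
    have hU2 := sq_nonneg U
    nlinarith


lemma cs_interval (f : ℝ → ℝ) (hf : Continuous f) (a b : ℝ) (hab : a ≤ b) :
    (∫ x in a..b, f x) ^ 2 ≤ (b - a) * ∫ x in a..b, f x ^ 2 := by
  rcases hab.lt_or_eq with h | h
  · have hL : 0 < b - a := by linarith
    set m := (∫ x in a..b, f x) / (b - a) with hm
    have h0 : 0 ≤ ∫ x in a..b, (f x - m) ^ 2 :=
      intervalIntegral.integral_nonneg hab (fun x _ => sq_nonneg _)
    have e : ∫ x in a..b, (f x - m) ^ 2
        = (∫ x in a..b, f x ^ 2) - 2 * m * (∫ x in a..b, f x) + (b - a) * m ^ 2 := by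
      have : ∀ x, (f x - m) ^ 2 = f x ^ 2 - 2 * m * f x + m ^ 2 := fun x => by ring
      simp only [this]
      rw [intervalIntegral.integral_add (Continuous.intervalIntegrable (by fun_prop) _ _)
        (Continuous.intervalIntegrable (by fun_prop) _ _),
        intervalIntegral.integral_sub (Continuous.intervalIntegrable (by fun_prop) _ _)
        (Continuous.intervalIntegrable (by fun_prop) _ _)]
      simp
    have hI : ∫ x in a..b, f x = m * (b - a) := by rw [hm]; field_simp
    rw [e, hI] at h0
    rw [hI]
    nlinarith
  · subst h; simp

lemma interp_pt (G E : ℝ → ℝ) (hE : Continuous E) (hG : ∀ x, HasDerivAt G (E x) x)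
    (a b x s : ℝ) (hab : a < b) (hs0 : 0 ≤ s) (hs1 : s ≤ 1) (hx : x = a + s * (b - a)) :
    (G x - (G a + s * (G b - G a))) ^ 2 ≤ (b - a) * ∫ y in a..b, E y ^ 2 := by
  have h1 : a ≤ x := by rw [hx]; nlinarith
  have h2 : x ≤ b := by rw [hx]; nlinarith
  have i : ∀ p q, IntervalIntegrable E MeasureTheory.volume p q := fun p q =>
    hE.intervalIntegrable _ _
  have i2 : ∀ p q, IntervalIntegrable (fun y => E y ^ 2) MeasureTheory.volume p q := fun p q =>
    Continuous.intervalIntegrable (by fun_prop) _ _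
  have f1 : ∫ y in a..x, E y = G x - G a :=
    intervalIntegral.integral_eq_sub_of_hasDerivAt (fun y _ => hG y) (i _ _)
  have f2 : ∫ y in x..b, E y = G b - G x :=
    intervalIntegral.integral_eq_sub_of_hasDerivAt (fun y _ => hG y) (i _ _)
  have c1 := cs_interval E hE a x h1
  have c2 := cs_interval E hE x b h2
  rw [f1] at c1
  rw [f2] at c2
  have hadd := intervalIntegral.integral_add_adjacent_intervals (i2 a x) (i2 x b)
  have n1 : 0 ≤ ∫ y in a..x, E y ^ 2 :=
    intervalIntegral.integral_nonneg h1 (fun x _ => sq_nonneg _)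
  have n2 : 0 ≤ ∫ y in x..b, E y ^ 2 :=
    intervalIntegral.integral_nonneg h2 (fun x _ => sq_nonneg _)
  rw [← hadd]
  set A := ∫ y in a..x, E y ^ 2
  set B := ∫ y in x..b, E y ^ 2
  set α := G x - G a
  set β := G b - G x
  have e : G x - (G a + s * (G b - G a)) = (1 - s) * α - s * β := by simp only [α, β]; ring
  rw [e]
  have k : ((1 - s) * α - s * β) ^ 2 ≤ (1 - s) * α ^ 2 + s * β ^ 2 := by
    have : 0 ≤ (s * (1 - s)) * (α + β) ^ 2 :=
      mul_nonneg (mul_nonneg hs0 (by linarith)) (sq_nonneg _)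
    nlinarith
  have c1' : α ^ 2 ≤ (b - a) * A :=
    c1.trans (mul_le_mul_of_nonneg_right (by linarith) n1)
  have c2' : β ^ 2 ≤ (b - a) * B :=
    c2.trans (mul_le_mul_of_nonneg_right (by linarith) n2)
  have t1 : (1 - s) * α ^ 2 ≤ (b - a) * A :=
    (mul_le_of_le_one_left (sq_nonneg _) (by linarith)).trans c1'
  have t2 : s * β ^ 2 ≤ (b - a) * B :=
    (mul_le_of_le_one_left (sq_nonneg _) (by linarith)).trans c2'
  linarith

lemma init_est (N : ℕ) [NeZero N] (e E : ℝ → ℝ) (he : Continuous e)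
    (hE : ∀ x, HasDerivAt E (e x) x)
    (hmean : ∫ x in (0 : ℝ)..1, E x = 0)
    (horth : ∀ v : ZMod N → ℝ, ∫ x in (0 : ℝ)..1, e x * plin N v x = 0) :
    ∫ x in (0 : ℝ)..1, E x ^ 2 ≤ (1 / (N : ℝ) ^ 2) * ∫ x in (0 : ℝ)..1, e x ^ 2 := by
  have hN : (0 : ℝ) < N := by exact_mod_cast Nat.pos_of_ne_zero (NeZero.ne N)
  have cE : Continuous E := continuous_iff_continuousAt.mpr fun x => (hE x).continuousAt
  set G : ℝ → ℝ := fun x => ∫ y in (0 : ℝ)..x, E y with hGdef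
  have hG : ∀ x, HasDerivAt G (E x) x := fun x =>
    intervalIntegral.integral_hasDerivAt_right (cE.intervalIntegrable _ _)
      (cE.stronglyMeasurableAtFilter _ _) cE.continuousAt
  have cG : Continuous G := continuous_iff_continuousAt.mpr fun x => (hG x).continuousAt
  have G0 : G 0 = 0 := by simp [hGdef]
  have G1 : G 1 = 0 := hmean
  let vg : ZMod N → ℝ := fun i => G ((i.val : ℝ) / N)
  have cp := plin_continuous N vg
  have hz := int_periodic_zero (fun x => E x * G x) (fun x => e x * G x + E x * E x) (by fun_prop)
    (fun x => ((hE x).mul (hG x)).hasDerivWithinAt)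
    (Continuous.intervalIntegrable (by fun_prop) _ _) (by simp [G0, G1])
  let c : ZMod N → ℝ := fun i => ∫ y in ((i.val : ℝ) / N)..(((i.val + 1 : ℕ) : ℝ) / N), E y ^ 2
  have hpt : ∀ x ∈ Ioo (0 : ℝ) 1, (G x - plin N vg x) ^ 2 ≤ pw N (fun i _ => (1 / N) * c i) x := by
    intro x hx
    set k := ⌊x * (N : ℝ)⌋ with hk
    have h1 : (k : ℝ) ≤ x * N := Int.floor_le _
    have h2 : x * N < k + 1 := Int.lt_floor_add_one _
    have hk0 : 0 ≤ k := Int.floor_nonneg.mpr (mul_nonneg hx.1.le hN.le)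
    obtain ⟨n, hn⟩ := Int.eq_ofNat_of_zero_le hk0
    have hkn : (k : ℝ) = (n : ℝ) := by rw [hn]; simp
    have hnN : n < N := by
      have : (n : ℝ) < N := by
        rw [← hkn]; refine h1.trans_lt ?_; nlinarith [hx.2]
      exact_mod_cast this
    have hval : ((k : ℤ) : ZMod N).val = n := by
      rw [hn]; simpa using ZMod.val_cast_of_lt hnN
    have hvg : vg ((k : ℤ) : ZMod N) = G ((n : ℝ) / N) := by simp only [vg, hval]
    have hvg1 : vg (((k : ℤ) : ZMod N) + 1) = G (((n + 1 : ℕ) : ℝ) / N) := by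
      have e1 : ((k : ℤ) : ZMod N) + 1 = ((n + 1 : ℕ) : ZMod N) := by rw [hn]; push_cast; rfl
      rcases (Nat.succ_le_of_lt hnN).lt_or_eq with h | h
      · simp only [vg]
        rw [e1, ZMod.val_cast_of_lt h]
      · have e2 : ((n + 1 : ℕ) : ZMod N) = 0 := by
          have : n + 1 = N := h
          rw [this]; simp
        have e3 : ((n + 1 : ℕ) : ℝ) = N := by exact_mod_cast h
        rw [e1, e2, e3, div_self hN.ne', G1]
        simp [vg, G0]
    rw [pw_eq_Ico N _ k x h1 h2, pw_plin, pw_eq_Ico N _ k x h1 h2]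
    simp only [hvg, hvg1, c, hval, hkn]
    have hlen : ((n + 1 : ℕ) : ℝ) / N - (n : ℝ) / N = 1 / N := by push_cast; ring
    have := interp_pt G E cE hG ((n : ℝ) / N) (((n + 1 : ℕ) : ℝ) / N) x (x * N - n)
      (by push_cast; gcongr; linarith) (by linarith) (by linarith)
      (by rw [hlen]; field_simp; ring)
    rw [hlen] at this
    exact this
  have hcs : ∑ i, c i = ∫ x in (0 : ℝ)..1, E x ^ 2 := by
    rw [← sum_range_zmod]
    have := intervalIntegral.sum_integral_adjacent_intervals (f := fun x => E x ^ 2)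
      (μ := MeasureTheory.volume)
      (a := fun k : ℕ => (k : ℝ) / N) (n := N)
      (fun k _ => Continuous.intervalIntegrable (by fun_prop) _ _)
    simp only [CharP.cast_eq_zero, zero_div, div_self hN.ne'] at this
    rw [← this]
    refine Finset.sum_congr rfl (fun k hk => ?_)
    simp only [c]
    rw [ZMod.val_cast_of_lt (by simpa using hk)]
  have hq : ∫ x in (0 : ℝ)..1, (G x - plin N vg x) ^ 2
      ≤ (1 / (N : ℝ) ^ 2) * ∫ x in (0 : ℝ)..1, E x ^ 2 := by
    have := intervalIntegral.integral_mono_on_of_le_Ioo (μ := MeasureTheory.volume) zero_le_one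
      (f := fun x => (G x - plin N vg x) ^ 2) (g := pw N (fun i _ => (1 / N) * c i))
      (Continuous.intervalIntegrable (by fun_prop) _ _)
      (pw_integrable N _ (fun i => continuous_const)) hpt
    refine this.trans (le_of_eq ?_)
    rw [pw_integral N _ (fun i => continuous_const)]
    simp only [intervalIntegral.integral_const, sub_zero, one_smul]
    rw [← Finset.mul_sum, hcs]; ring
  have ho := horth vg
  have i1 : IntervalIntegrable (fun x => e x * G x) MeasureTheory.volume 0 1 :=
    Continuous.intervalIntegrable (by fun_prop) _ _
  have i2 : IntervalIntegrable (fun x => E x * E x) MeasureTheory.volume 0 1 :=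
    Continuous.intervalIntegrable (by fun_prop) _ _
  have i3 : IntervalIntegrable (fun x => e x * plin N vg x) MeasureTheory.volume 0 1 :=
    Continuous.intervalIntegrable (by fun_prop) _ _
  rw [intervalIntegral.integral_add i1 i2] at hz
  have hX : ∫ x in (0 : ℝ)..1, E x ^ 2
      = ∫ x in (0 : ℝ)..1, -(e x * (G x - plin N vg x)) := by
    have : ∀ x, -(e x * (G x - plin N vg x)) = e x * plin N vg x - e x * G x := fun x => by ring
    simp only [this]
    rw [intervalIntegral.integral_sub i3 i1, ho]
    have e2 : ∀ x, E x ^ 2 = E x * E x := fun x => by ring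
    simp only [e2]; linarith
  have hle : ∫ x in (0 : ℝ)..1, -(e x * (G x - plin N vg x))
      ≤ ∫ x in (0 : ℝ)..1, ((1 / (2 * (N : ℝ) ^ 2)) * e x ^ 2
        + ((N : ℝ) ^ 2 / 2) * (G x - plin N vg x) ^ 2) := by
    refine intervalIntegral.integral_mono_on zero_le_one
      (Continuous.intervalIntegrable (by fun_prop) _ _)
      (Continuous.intervalIntegrable (by fun_prop) _ _) (fun x _ => ?_)
    set q := G x - plin N vg x
    have : (1 / (2 * (N : ℝ) ^ 2)) * e x ^ 2 + ((N : ℝ) ^ 2 / 2) * q ^ 2 + e x * q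
      = (1 / 2) * (e x / N + N * q) ^ 2 := by field_simp; ring
    nlinarith [sq_nonneg (e x / N + N * q)]
  rw [intervalIntegral.integral_add (Continuous.intervalIntegrable (by fun_prop) _ _)
        (Continuous.intervalIntegrable (by fun_prop) _ _),
      intervalIntegral.integral_const_mul, intervalIntegral.integral_const_mul, ← hX] at hle
  set X := ∫ x in (0 : ℝ)..1, E x ^ 2
  set Y := ∫ x in (0 : ℝ)..1, e x ^ 2
  have : ((N : ℝ) ^ 2 / 2) * (∫ x in (0 : ℝ)..1, (G x - plin N vg x) ^ 2) ≤ X / 2 := by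
    calc _ ≤ ((N : ℝ) ^ 2 / 2) * ((1 / (N : ℝ) ^ 2) * X) :=
          mul_le_mul_of_nonneg_left hq (by positivity)
      _ = X / 2 := by field_simp
  have e3 : 1 / (2 * (N : ℝ) ^ 2) * Y = (1 / 2) * (1 / (N : ℝ) ^ 2 * Y) := by field_simp
  rw [e3] at hle
  linarith

lemma lumped_norm (N : ℕ) [NeZero N] (v : ZMod N → ℝ) :
    (1 / N) * ∑ i, v i ^ 2 ≤ 3 * ∫ x in (0 : ℝ)..1, plin N v x ^ 2 := by
  have h : ∫ x in (0 : ℝ)..1, plin N v x ^ 2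
      = (1 / N) * ∑ i, ∫ s in (0 : ℝ)..1, (v i + s * (v (i + 1) - v i)) ^ 2 :=
    pw_integral N (fun i s => (v i + s * (v (i + 1) - v i)) ^ 2) (fun i => by fun_prop)
  have h2 : ∀ i, ∫ s in (0 : ℝ)..1, (v i + s * (v (i + 1) - v i)) ^ 2
      = (v i ^ 2 + v i * v (i + 1) + v (i + 1) ^ 2) / 3 := by
    intro i
    have := intervalIntegral.integral_eq_sub_of_hasDerivAt (a := 0) (b := 1)
      (f := fun s : ℝ => v i ^ 2 * s + v i * (v (i + 1) - v i) * s ^ 2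
        + (v (i + 1) - v i) ^ 2 / 3 * s ^ 3)
      (f' := fun s => (v i + s * (v (i + 1) - v i)) ^ 2) (fun s _ => ?_)
      (Continuous.intervalIntegrable (by fun_prop) _ _)
    · rw [this]; ring
    · have h2 : HasDerivAt (fun s : ℝ => s ^ 2) (2 * s) s := by
        simpa using (hasDerivAt_id s).fun_pow 2
      have h3 : HasDerivAt (fun s : ℝ => s ^ 3) (3 * s ^ 2) s := by
        simpa using (hasDerivAt_id s).fun_pow 3
      have := (((hasDerivAt_const_mul (x := s) (v i ^ 2))).add
        (h2.const_mul (v i * (v (i + 1) - v i)))).add (h3.const_mul ((v (i + 1) - v i) ^ 2 / 3))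
      refine this.congr_deriv ?_
      ring
  rw [h]
  simp only [h2]
  have h3 : ∑ i, (v i ^ 2 / 6 + v (i + 1) ^ 2 / 6)
      ≤ ∑ i, (v i ^ 2 + v i * v (i + 1) + v (i + 1) ^ 2) / 3 :=
    Finset.sum_le_sum (fun i _ => by nlinarith [sq_nonneg (v i + v (i + 1))])
  rw [Finset.sum_add_distrib, sum_shift N (fun i => v i ^ 2 / 6), ← Finset.sum_div] at h3
  have hN : (0 : ℝ) ≤ 1 / N := by positivity
  have := mul_le_mul_of_nonneg_left h3 hN
  linarith

lemma filter_est (δ : ℝ) (hδ : 0 < δ) (e E p : ℝ → ℝ)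
    (hE : ∀ x, HasDerivAt E (e x) x) (hEp : E 1 = E 0)
    (hp : ContDiff ℝ 2 p) (hper : ∀ x, p (x + 1) = p x)
    (hf : ∀ x, -δ ^ 2 * iteratedDeriv 2 p x + p x = e x) :
    δ ^ 2 * (∫ x in (0 : ℝ)..1, deriv p x ^ 2) + ∫ x in (0 : ℝ)..1, p x ^ 2
      ≤ (1 / δ ^ 2) * ∫ x in (0 : ℝ)..1, E x ^ 2 := by
  have cE : Continuous E := continuous_iff_continuousAt.mpr fun x => (hE x).continuousAt
  have cp : Continuous p := hp.continuous
  have hd1 : ContDiff ℝ 1 (deriv p) := by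
    have : ContDiff ℝ (1 + 1) p := by simpa [one_add_one_eq_two] using hp
    exact ((contDiff_succ_iff_deriv).mp this).2.2
  have cdp : Continuous (deriv p) := hd1.continuous
  have hp1 : ∀ x, HasDerivAt p (deriv p x) x := fun x =>
    ((hp.differentiable (by norm_num)) x).hasDerivAt
  have hp2 : ∀ x, HasDerivAt (deriv p) (iteratedDeriv 2 p x) x := fun x => by
    have := ((hd1.differentiable (by norm_num)) x).hasDerivAt
    have e2 : iteratedDeriv 2 p = deriv (deriv p) := by
      rw [iteratedDeriv_succ, iteratedDeriv_one]
    rwa [e2]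
  have c2 : Continuous (iteratedDeriv 2 p) := hp.continuous_iteratedDeriv 2 le_rfl
  have ce : Continuous e := by
    have : e = fun x => -δ ^ 2 * iteratedDeriv 2 p x + p x := funext fun x => (hf x).symm
    rw [this]; fun_prop
  have hdper : deriv p 1 = deriv p 0 := by
    have : deriv (fun x => p (x + 1)) 0 = deriv p (0 + 1) := deriv_comp_add_const p 1 0
    have h2 : (fun x => p (x + 1)) = p := funext hper
    rw [h2] at this; simpa using this.symm
  have p10 : p 1 = p 0 := by simpa using hper 0
  have hz := int_periodic_zero (fun x => E x * p x + δ ^ 2 * (p x * deriv p x))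
    (fun x => (e x * p x + E x * deriv p x) + δ ^ 2 * (deriv p x * deriv p x
      + p x * iteratedDeriv 2 p x)) (by fun_prop)
    (fun x => (((hE x).mul (hp1 x)).add (((hp1 x).mul (hp2 x)).const_mul (δ ^ 2))).hasDerivWithinAt)
    (Continuous.intervalIntegrable (by fun_prop) _ _) (by simp only [hEp, p10, hdper])
  have i0 : IntervalIntegrable (fun x => (e x * p x + E x * deriv p x) + δ ^ 2 *
      (deriv p x * deriv p x + p x * iteratedDeriv 2 p x)) MeasureTheory.volume 0 1 :=
    Continuous.intervalIntegrable (by fun_prop) _ _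
  have i1 : IntervalIntegrable (fun x => deriv p x ^ 2) MeasureTheory.volume 0 1 :=
    Continuous.intervalIntegrable (by fun_prop) _ _
  have i2 : IntervalIntegrable (fun x => p x ^ 2) MeasureTheory.volume 0 1 :=
    Continuous.intervalIntegrable (by fun_prop) _ _
  have i3 : IntervalIntegrable (fun x => E x ^ 2) MeasureTheory.volume 0 1 :=
    Continuous.intervalIntegrable (by fun_prop) _ _
  have hle : ∫ x in (0 : ℝ)..1, ((δ ^ 2 / 2) * deriv p x ^ 2 + p x ^ 2)
      ≤ ∫ x in (0 : ℝ)..1, (((e x * p x + E x * deriv p x) + δ ^ 2 *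
      (deriv p x * deriv p x + p x * iteratedDeriv 2 p x)) + (1 / (2 * δ ^ 2)) * E x ^ 2) := by
    refine intervalIntegral.integral_mono_on zero_le_one ((i1.const_mul _).add i2)
      (i0.add (i3.const_mul _)) (fun x _ => ?_)
    have h1 := hf x
    have h2 : (1 / (2 * δ ^ 2)) * E x ^ 2 + E x * deriv p x + (δ ^ 2 / 2) * deriv p x ^ 2
      = (1 / 2) * (E x / δ + δ * deriv p x) ^ 2 := by field_simp; ring
    have h3 := sq_nonneg (E x / δ + δ * deriv p x)
    have h4 : e x * p x = -δ ^ 2 * (p x * iteratedDeriv 2 p x) + p x ^ 2 := by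
      rw [← h1]; ring
    rw [h4]
    nlinarith
  rw [intervalIntegral.integral_add (i1.const_mul _) i2,
    intervalIntegral.integral_add i0 (i3.const_mul _), hz,
    intervalIntegral.integral_const_mul, intervalIntegral.integral_const_mul] at hle
  have hP : 0 ≤ ∫ x in (0 : ℝ)..1, p x ^ 2 :=
    intervalIntegral.integral_nonneg zero_le_one (fun x _ => sq_nonneg _)
  set Q := ∫ x in (0 : ℝ)..1, E x ^ 2
  have e3 : 1 / (2 * δ ^ 2) * Q = (1 / 2) * (1 / δ ^ 2 * Q) := by field_simp
  rw [e3] at hle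
  linarith

lemma sum_energy (N : ℕ) [NeZero N] (m : ℝ) (v v' : ZMod N → ℝ)
    (hv : ∀ i, v' i = -N * (GN N m v i - GN N m v (i - 1))) :
    ∑ i, v i * v' i = -(m * N ^ 2) * ∑ i, (v (i + 1) - v i) ^ 2 := by
  have h1 : ∑ i, v i * v' i = -N * (∑ i, v i * GN N m v i - ∑ i, v i * GN N m v (i - 1)) := by
    rw [← Finset.sum_sub_distrib, Finset.mul_sum]
    exact Finset.sum_congr rfl (fun i _ => by rw [hv]; ring)
  have h2 : ∑ i, v i * GN N m v (i - 1) = ∑ i, v (i + 1) * GN N m v i := by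
    rw [← sum_shift N (fun i => v i * GN N m v (i - 1))]
    exact Finset.sum_congr rfl (fun i _ => by rw [add_sub_cancel_right])
  have h3 : ∑ i, v i * GN N m v i - ∑ i, v (i + 1) * GN N m v i
      = (∑ i, v i ^ 3 / 6 - ∑ i, v (i + 1) ^ 3 / 6) + m * N * ∑ i, (v (i + 1) - v i) ^ 2 := by
    rw [← Finset.sum_sub_distrib, ← Finset.sum_sub_distrib, Finset.mul_sum,
      ← Finset.sum_add_distrib]
    exact Finset.sum_congr rfl (fun i _ => by unfold GN; ring)
  rw [h1, h2, h3, sum_shift N (fun i => v i ^ 3 / 6)]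
  ring


/-- family of functions that can be differentiated under the integral -/
structure PI (T : ℝ) (f ft : ℝ → ℝ → ℝ) : Prop where
  cx : ∀ t ∈ Icc (0 : ℝ) T, ContinuousOn (fun x => f x t) (Icc 0 1)
  cx' : ∀ t ∈ Ioo (0 : ℝ) T, ContinuousOn (fun x => ft x t) (Icc 0 1)
  bd : ∃ C, ∀ x ∈ Icc (0 : ℝ) 1, ∀ t ∈ Icc (0 : ℝ) T, |f x t| ≤ C
  bd' : ∃ C, ∀ x ∈ Icc (0 : ℝ) 1, ∀ t ∈ Ioo (0 : ℝ) T, |ft x t| ≤ C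
  ct : ∀ x ∈ Icc (0 : ℝ) 1, ContinuousOn (f x) (Icc 0 T)
  dt : ∀ x ∈ Icc (0 : ℝ) 1, ∀ t ∈ Ioo (0 : ℝ) T, HasDerivAt (f x) (ft x t) t

lemma bd_prim (g : ℝ → ℝ) (C : ℝ) (hC : ∀ x ∈ Icc (0 : ℝ) 1, |g x| ≤ C) (x : ℝ)
    (hx : x ∈ Icc (0 : ℝ) 1) : |∫ y in (0 : ℝ)..x, g y| ≤ C := by
  have hC0 : 0 ≤ C := (abs_nonneg _).trans (hC 0 ⟨le_rfl, zero_le_one⟩)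
  have := intervalIntegral.norm_integral_le_of_norm_le_const (a := 0) (b := x) (f := g) (C := C)
    (fun y hy => by
      rw [uIoc_of_le hx.1] at hy
      exact hC y ⟨hy.1.le, hy.2.trans hx.2⟩)
  rw [Real.norm_eq_abs, sub_zero, abs_of_nonneg hx.1] at this
  exact this.trans (mul_le_of_le_one_right hC0 hx.2)

lemma cont_prim (g : ℝ → ℝ) (hg : ContinuousOn g (Icc 0 1)) :
    ContinuousOn (fun x => ∫ y in (0 : ℝ)..x, g y) (Icc 0 1) := by
  have := intervalIntegral.continuousOn_primitive_interval (μ := MeasureTheory.volume) (f := g)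
    (a := 0) (b := 1)
    (by rw [uIcc_of_le zero_le_one]; exact hg.integrableOn_Icc)
  rwa [uIcc_of_le zero_le_one] at this

lemma PI.prim {T : ℝ} {f ft : ℝ → ℝ → ℝ} (h : PI T f ft) :
    PI T (fun x t => ∫ y in (0 : ℝ)..x, f y t) (fun x t => ∫ y in (0 : ℝ)..x, ft y t) := by
  obtain ⟨C, hC⟩ := h.bd
  obtain ⟨C', hC'⟩ := h.bd'
  have sub : ∀ x ∈ Icc (0 : ℝ) 1, uIoc 0 x ⊆ Icc (0 : ℝ) 1 := fun x hx y hy => by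
    rw [uIoc_of_le hx.1] at hy
    exact ⟨hy.1.le, hy.2.trans hx.2⟩
  have sub2 : ∀ x ∈ Icc (0 : ℝ) 1, uIcc 0 x ⊆ Icc (0 : ℝ) 1 := fun x hx y hy => by
    rw [uIcc_of_le hx.1] at hy
    exact ⟨hy.1, hy.2.trans hx.2⟩
  refine ⟨fun t ht => cont_prim _ (h.cx t ht), fun t ht => cont_prim _ (h.cx' t ht),
    ⟨C, fun x hx t ht => bd_prim _ C (fun y hy => hC y hy t ht) x hx⟩,
    ⟨C', fun x hx t ht => bd_prim _ C' (fun y hy => hC' y hy t ht) x hx⟩, ?_, ?_⟩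
  · intro x hx t ht
    refine intervalIntegral.continuousWithinAt_of_dominated_interval (bound := fun _ => C)
      (F := fun t y => f y t) ?_ ?_ ?_ ?_
    · filter_upwards [self_mem_nhdsWithin] with s hs
      exact ((h.cx s hs).mono (sub x hx)).aestronglyMeasurable measurableSet_uIoc
    · filter_upwards [self_mem_nhdsWithin] with s hs
      exact Filter.Eventually.of_forall (fun y hy => hC y (sub x hx hy) s hs)
    · exact continuous_const.intervalIntegrable _ _
    · exact Filter.Eventually.of_forall (fun y hy => h.ct y (sub x hx hy) t ht)
  · intro x hx t ht
    have hnb : Ioo (0 : ℝ) T ∈ nhds t := Ioo_mem_nhds ht.1 ht.2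
    refine (intervalIntegral.hasDerivAt_integral_of_dominated_loc_of_deriv_le
      (bound := fun _ => C') (F := fun t y => f y t) (F' := fun t y => ft y t)
      hnb ?_ ?_ ?_ ?_ ?_ ?_).2
    · filter_upwards [hnb] with s hs
      exact ((h.cx s ⟨hs.1.le, hs.2.le⟩).mono (sub x hx)).aestronglyMeasurable measurableSet_uIoc
    · exact ((h.cx t ⟨ht.1.le, ht.2.le⟩).mono (sub2 x hx)).intervalIntegrable
    · exact ((h.cx' t ht).mono (sub x hx)).aestronglyMeasurable measurableSet_uIoc
    · exact Filter.Eventually.of_forall (fun y hy s hs => hC' y (sub x hx hy) s hs)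
    · exact continuous_const.intervalIntegrable _ _
    · exact Filter.Eventually.of_forall (fun y hy s hs => h.dt y (sub x hx hy) s hs)

lemma PI.total {T : ℝ} {f ft : ℝ → ℝ → ℝ} (h : PI T f ft) :
    PI T (fun _ t => ∫ y in (0 : ℝ)..1, f y t) (fun _ t => ∫ y in (0 : ℝ)..1, ft y t) := by
  have hp := h.prim
  have h1 : (1 : ℝ) ∈ Icc (0 : ℝ) 1 := ⟨zero_le_one, le_rfl⟩
  obtain ⟨C, hC⟩ := hp.bd
  obtain ⟨C', hC'⟩ := hp.bd'
  exact ⟨fun t ht => continuousOn_const, fun t ht => continuousOn_const,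
    ⟨C, fun x hx t ht => hC 1 h1 t ht⟩, ⟨C', fun x hx t ht => hC' 1 h1 t ht⟩,
    fun x hx => hp.ct 1 h1, fun x hx t ht => hp.dt 1 h1 t ht⟩

lemma PI.sub {T : ℝ} {f ft g gt : ℝ → ℝ → ℝ} (h : PI T f ft) (k : PI T g gt) :
    PI T (fun x t => f x t - g x t) (fun x t => ft x t - gt x t) := by
  obtain ⟨C, hC⟩ := h.bd
  obtain ⟨C', hC'⟩ := h.bd'
  obtain ⟨B, hB⟩ := k.bd
  obtain ⟨B', hB'⟩ := k.bd'
  exact ⟨fun t ht => (h.cx t ht).sub (k.cx t ht), fun t ht => (h.cx' t ht).sub (k.cx' t ht),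
    ⟨C + B, fun x hx t ht => (abs_sub _ _).trans (add_le_add (hC x hx t ht) (hB x hx t ht))⟩,
    ⟨C' + B', fun x hx t ht => (abs_sub _ _).trans (add_le_add (hC' x hx t ht) (hB' x hx t ht))⟩,
    fun x hx => (h.ct x hx).sub (k.ct x hx), fun x hx t ht => (h.dt x hx t ht).sub (k.dt x hx t ht)⟩

lemma PI.sq {T : ℝ} {f ft : ℝ → ℝ → ℝ} (h : PI T f ft) :
    PI T (fun x t => f x t ^ 2) (fun x t => 2 * f x t * ft x t) := by
  obtain ⟨C, hC⟩ := h.bd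
  obtain ⟨C', hC'⟩ := h.bd'
  refine ⟨fun t ht => (h.cx t ht).pow 2,
    fun t ht => ((h.cx t ⟨ht.1.le, ht.2.le⟩).const_mul 2).mul (h.cx' t ht),
    ⟨C ^ 2, fun x hx t ht => ?_⟩, ⟨2 * C * C', fun x hx t ht => ?_⟩,
    fun x hx => (h.ct x hx).pow 2, fun x hx t ht => ?_⟩
  · rw [abs_pow]; exact pow_le_pow_left₀ (abs_nonneg _) (hC x hx t ht) 2
  · rw [abs_mul, abs_mul, abs_two]
    have a1 := hC x hx t ⟨ht.1.le, ht.2.le⟩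
    have a2 := hC' x hx t ht
    have : 0 ≤ C := (abs_nonneg _).trans a1
    gcongr
  · simpa using (h.dt x hx t ht).fun_pow 2

lemma plin_sum (N : ℕ) [NeZero N] (w : ℝ → ZMod N → ℝ) (w' : ZMod N → ℝ) (t x : ℝ)
    (hd : ∀ i, HasDerivAt (fun s => w s i) (w' i) t) :
    HasDerivAt (fun s => plin N (w s) x) (plin N w' x) t := by
  unfold plin
  exact (hd _).add (((hd _).sub (hd _)).const_mul _)

lemma PI_error (N : ℕ) [NeZero N] (T : ℝ) (u ut : ℝ → ℝ → ℝ) (w w' : ℝ → ZMod N → ℝ)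
    (hcu : Continuous fun p : ℝ × ℝ => u p.1 p.2)
    (hcut : Continuous fun p : ℝ × ℝ => ut p.1 p.2)
    (ht : ∀ x, ∀ t ∈ Icc (0 : ℝ) T,
        HasDerivWithinAt (fun s => u x s) (ut x t) (Icc (0 : ℝ) T) t)
    (hd : ∀ i, ∀ t ∈ Icc (0 : ℝ) T,
        HasDerivWithinAt (fun s => w s i) (w' t i) (Icc (0 : ℝ) T) t)
    (hcw' : ∀ i, ContinuousOn (fun s => w' s i) (Icc 0 T)) :
    PI T (fun x t => u x t - plin N (w t) x) (fun x t => ut x t - plin N (w' t) x) := by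
  have hK : IsCompact (Icc (0 : ℝ) 1 ×ˢ Icc (0 : ℝ) T) := isCompact_Icc.prod isCompact_Icc
  have hcw : ∀ i, ContinuousOn (fun s => w s i) (Icc 0 T) := fun i t ht =>
    (hd i t ht).continuousWithinAt
  refine PI.sub ⟨?_, ?_, ?_, ?_, ?_, ?_⟩ ⟨?_, ?_, ?_, ?_, ?_, ?_⟩
  · intro t _; exact (hcu.comp (f := fun x : ℝ => (x, t)) (by fun_prop)).continuousOn
  · intro t _; exact (hcut.comp (f := fun x : ℝ => (x, t)) (by fun_prop)).continuousOn
  · obtain ⟨C, hC⟩ := hK.exists_bound_of_continuousOn hcu.continuousOn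
    exact ⟨C, fun x hx t ht => hC (x, t) ⟨hx, ht⟩⟩
  · obtain ⟨C, hC⟩ := hK.exists_bound_of_continuousOn hcut.continuousOn
    exact ⟨C, fun x hx t ht => hC (x, t) ⟨hx, ht.1.le, ht.2.le⟩⟩
  · intro x _; exact (hcu.comp (f := fun t : ℝ => (x, t)) (by fun_prop)).continuousOn
  · intro x _ t htI; exact (ht x t ⟨htI.1.le, htI.2.le⟩).hasDerivAt (Icc_mem_nhds htI.1 htI.2)
  · intro t _; exact (plin_continuous N _).continuousOn
  · intro t _; exact (plin_continuous N _).continuousOn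
  · obtain ⟨B, _, hB⟩ := exists_bound N T w hcw
    exact ⟨B, fun x _ t ht => plin_abs_le N _ B (fun i => hB i t ht) x⟩
  · obtain ⟨B, _, hB⟩ := exists_bound N T w' hcw'
    exact ⟨B, fun x _ t ht => plin_abs_le N _ B (fun i => hB i t ⟨ht.1.le, ht.2.le⟩) x⟩
  · intro x _
    unfold plin
    exact (hcw _).add (continuousOn_const.mul ((hcw _).sub (hcw _)))
  · intro x _ t htI
    exact plin_sum N w (w' t) t x
      (fun i => (hd i t ⟨htI.1.le, htI.2.le⟩).hasDerivAt (Icc_mem_nhds htI.1 htI.2))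


lemma constant_of_has_deriv_right_zero' (T : ℝ) (f : ℝ → ℝ) (hc : ContinuousOn f (Icc 0 T))
    (hd : ∀ s ∈ Ioo (0 : ℝ) T, HasDerivAt f 0 s) : ∀ s ∈ Icc (0 : ℝ) T, f s = f 0 := by
  intro s hs
  rcases hs.1.eq_or_lt with h | h
  · rw [← h]
  obtain ⟨c, hc1, hc2⟩ := exists_hasDerivAt_eq_slope f (fun _ => 0) h
    (hc.mono (Icc_subset_Icc le_rfl hs.2)) (fun x hx => hd x ⟨hx.1, hx.2.trans_le hs.2⟩)
  have : f s - f 0 = 0 := by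
    have h' : s - 0 ≠ 0 := by linarith
    field_simp at hc2
    linarith
  linarith


lemma resid_prim (N : ℕ) [NeZero N] (ν m : ℝ) (v v' : ZMod N → ℝ) (u ux uxx ut : ℝ → ℝ)
    (hut : Continuous ut)
    (hux : ∀ x, HasDerivAt u (ux x) x) (huxx : ∀ x, HasDerivAt ux (uxx x) x)
    (hpde : ∀ x, ut x + u x * ux x - ν * uxx x = 0)
    (hv : ∀ i, v' i = -N * (GN N m v i - GN N m v (i - 1))) (x : ℝ) :
    ∫ y in (0 : ℝ)..x, (ut y - plin N v' y)
      = (-u x ^ 2 / 2 + ν * ux x + pw N (GF N m v) x)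
        - (-u 0 ^ 2 / 2 + ν * ux 0 + pw N (GF N m v) 0) := by
  have cu : Continuous u := continuous_iff_continuousAt.mpr fun x => (hux x).continuousAt
  have cux : Continuous ux := continuous_iff_continuousAt.mpr fun x => (huxx x).continuousAt
  have cG := GF_cont N m v
  have cp := plin_continuous N v'
  refine intervalIntegral.integral_eq_sub_of_hasDeriv_right
    (f := fun x => -u x ^ 2 / 2 + ν * ux x + pw N (GF N m v) x) ?_ ?_ ?_
  · exact Continuous.continuousOn (by fun_prop)
  · intro y _
    have h1 := (((hux y).fun_pow 2).fun_neg.div_const 2).hasDerivWithinAt (s := Ioi y)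
    have h2 := ((huxx y).const_mul ν).hasDerivWithinAt (s := Ioi y)
    have h3 := GF_deriv N m v v' hv y
    refine ((h1.add h2).add h3).congr_deriv ?_
    have := hpde y
    simp
    linarith
  · exact (hut.sub cp).intervalIntegrable _ _

lemma energy_decay (N : ℕ) [NeZero N] (T ν m U D : ℝ) (hT : 0 < T) (hν : 0 ≤ ν)
    (u ux uxx ut : ℝ → ℝ → ℝ) (w w' : ℝ → ZMod N → ℝ)
    (hper : ∀ x t, u (x + 1) t = u x t)
    (hcu : Continuous fun p : ℝ × ℝ => u p.1 p.2)
    (hcut : Continuous fun p : ℝ × ℝ => ut p.1 p.2)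
    (hx : ∀ x t, HasDerivAt (fun y => u y t) (ux x t) x)
    (hxx : ∀ x t, HasDerivAt (fun y => ux y t) (uxx x t) x)
    (ht : ∀ x, ∀ t ∈ Icc (0 : ℝ) T,
        HasDerivWithinAt (fun s => u x s) (ut x t) (Icc (0 : ℝ) T) t)
    (hpde : ∀ x, ∀ t ∈ Ioc (0 : ℝ) T,
        ut x t + u x t * ux x t - ν * uxx x t = 0)
    (hd : ∀ i, ∀ t ∈ Icc (0 : ℝ) T,
        HasDerivWithinAt (fun s => w s i) (w' t i) (Icc (0 : ℝ) T) t)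
    (hm1 : U / 2 ≤ m * N) (hm2 : ν ≤ m) (hm3 : (m - ν) * N ≤ U / 2)
    (hwU : ∀ i, ∀ t ∈ Icc (0 : ℝ) T, |w t i| ≤ U)
    (hD : ∀ t ∈ Icc (0 : ℝ) T, ∀ x i, (ux x t + N * (w t (i + 1) - w t i)) / 2 ≤ D)
    (hD0 : 0 ≤ D)
    (hv : ∀ t ∈ Icc (0 : ℝ) T, ∀ i,
      w' t i = -N * (GN N m (w t) i - GN N m (w t) (i - 1)))
    (h0 : ∫ x in (0 : ℝ)..1, (u x 0 - plin N (w 0) x) = 0) :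
    ∃ E : ℝ → ℝ → ℝ, (∀ t x, HasDerivAt (E t) (u x t - plin N (w t) x) x) ∧
      (∀ t, ∫ x in (0 : ℝ)..1, E t x = 0) ∧ (∀ t ∈ Icc (0 : ℝ) T, E t 1 = E t 0) ∧
      Real.exp (-(D + 1 / T) * T) * (∫ x in (0 : ℝ)..1, E T x ^ 2) ≤
        (∫ x in (0 : ℝ)..1, E 0 x ^ 2)
          + (144 * T * U / N + 1 / (4 * (N : ℝ) ^ 2)) * ((1 / N) * ∑ i, w 0 i ^ 2) := by
  have hN : (0 : ℝ) < N := by exact_mod_cast Nat.pos_of_ne_zero (NeZero.ne N)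
  have hU0 : 0 ≤ U := (abs_nonneg _).trans (hwU 0 0 ⟨le_rfl, hT.le⟩)
  have hcw : ∀ i, ContinuousOn (fun s => w s i) (Icc 0 T) := fun i t ht =>
    (hd i t ht).continuousWithinAt
  have hcw' : ∀ i, ContinuousOn (fun s => w' s i) (Icc 0 T) := by
    intro i
    have : ContinuousOn (fun s => -N * (GN N m (w s) i - GN N m (w s) (i - 1))) (Icc 0 T) := by
      unfold GN
      have a1 := hcw i
      have a2 := hcw (i + 1)
      have a3 := hcw (i - 1)
      have a4 := hcw (i - 1 + 1)
      fun_prop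
    exact this.congr (fun s hs => hv s hs i)
  have hPI := PI_error N T u ut w w' hcu hcut ht hd hcw'
  have ce : ∀ t, Continuous (fun x => u x t - plin N (w t) x) := fun t =>
    (hcu.comp (f := fun x : ℝ => (x, t)) (by fun_prop)).sub (plin_continuous N _)
  have cut : ∀ t, Continuous (fun x => ut x t) := fun t =>
    hcut.comp (f := fun x : ℝ => (x, t)) (by fun_prop)
  have cux : ∀ t, Continuous (fun x => ux x t) := fun t =>
    continuous_iff_continuousAt.mpr fun x => (hxx x t).continuousAt
  have cu : ∀ t, Continuous (fun x => u x t) := fun t =>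
    continuous_iff_continuousAt.mpr fun x => (hx x t).continuousAt
  have hup : ∀ t, u 1 t = u 0 t := fun t => by simpa using hper 0 t
  have huxp : ∀ t, ux 1 t = ux 0 t := by
    intro t
    have a1 := (hx (0 + 1) t).comp_add_const 0 1
    simp only [hper] at a1
    have := a1.unique (hx 0 t)
    simpa using this
  have hin : ∀ t ∈ Ioo (0 : ℝ) T, t ∈ Icc (0 : ℝ) T := fun t h => ⟨h.1.le, h.2.le⟩
  have hr : ∀ t ∈ Ioo (0 : ℝ) T, ∀ x, ∫ y in (0 : ℝ)..x, (ut y t - plin N (w' t) y)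
      = (-u x t ^ 2 / 2 + ν * ux x t + pw N (GF N m (w t)) x)
        - (-u 0 t ^ 2 / 2 + ν * ux 0 t + pw N (GF N m (w t)) 0) := fun t htt x =>
    resid_prim N ν m (w t) (w' t) (fun x => u x t) (fun x => ux x t) (fun x => uxx x t)
      (fun x => ut x t) (cut t) (fun x => hx x t) (fun x => hxx x t)
      (fun x => hpde x t ⟨htt.1, htt.2.le⟩) (hv t (hin t htt)) x
  -- mean of the error vanishes
  have hmean : ∀ t ∈ Icc (0 : ℝ) T, ∫ x in (0 : ℝ)..1, (u x t - plin N (w t) x) = 0 := by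
    have hp := hPI.total
    have z : (0 : ℝ) ∈ Icc (0 : ℝ) 1 := ⟨le_rfl, zero_le_one⟩
    intro t htt
    have key : ∀ s ∈ Icc (0 : ℝ) T, (fun t => ∫ x in (0 : ℝ)..1, (u x t - plin N (w t) x)) s
        = (fun t => ∫ x in (0 : ℝ)..1, (u x t - plin N (w t) x)) 0 := by
      refine constant_of_has_deriv_right_zero' T _ (hp.ct 0 z) (fun s hs => ?_)
      have a := hp.dt 0 z s hs
      have b := hr s hs 1
      rw [huxp, hup] at b
      have c := pw_periodic N (GF N m (w s)) 0
      rw [zero_add] at c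
      rw [c, sub_self] at b
      rw [b] at a
      exact a
    have := key t htt
    simp only at this
    rw [this, h0]

  have hP := hPI.prim
  have hB := hP.sub hP.total
  have hS := hB.sq.total
  set E : ℝ → ℝ → ℝ := fun t x => (∫ y in (0 : ℝ)..x, (u y t - plin N (w t) y))
    - ∫ x in (0 : ℝ)..1, ∫ y in (0 : ℝ)..x, (u y t - plin N (w t) y) with hE
  have hEd : ∀ t x, HasDerivAt (E t) (u x t - plin N (w t) x) x := fun t x =>
    (intervalIntegral.integral_hasDerivAt_right ((ce t).intervalIntegrable _ _)
      ((ce t).stronglyMeasurableAtFilter _ _) (ce t).continuousAt).sub_const _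
  have cE : ∀ t, Continuous (E t) := fun t =>
    continuous_iff_continuousAt.mpr fun x => (hEd t x).continuousAt
  have cP : ∀ t, Continuous (fun x => ∫ y in (0 : ℝ)..x, (u y t - plin N (w t) y)) := fun t =>
    intervalIntegral.continuous_primitive (fun a b => (ce t).intervalIntegrable a b) 0
  have hE0 : ∀ t, ∫ x in (0 : ℝ)..1, E t x = 0 := by
    intro t
    simp only [hE]
    rw [intervalIntegral.integral_sub ((cP t).intervalIntegrable _ _)
      intervalIntegrable_const]
    simp
  have hEp : ∀ t ∈ Icc (0 : ℝ) T, E t 1 = E t 0 := by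
    intro t htt
    simp only [hE, hmean t htt, intervalIntegral.integral_same]
  refine ⟨E, hEd, hE0, hEp, ?_⟩
  have z : (0 : ℝ) ∈ Icc (0 : ℝ) 1 := ⟨le_rfl, zero_le_one⟩
  set Q : ℝ → ℝ := fun t => ∫ x in (0 : ℝ)..1, E t x ^ 2 with hQ
  have cQ : ContinuousOn Q (Icc 0 T) := hS.ct 0 z
  set s2 : ℝ → ℝ := fun t => (1 / N) * ∑ i, (w t (i + 1) - w t i) ^ 2 with hs2
  have hs2n : ∀ t, 0 ≤ s2 t := fun t => by
    simp only [hs2]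
    have := Finset.sum_nonneg (s := Finset.univ)
      (fun i (_ : i ∈ Finset.univ) => sq_nonneg (w t (i + 1) - w t i))
    positivity
  have hQd : ∀ t ∈ Ioo (0 : ℝ) T, ∃ q, HasDerivAt Q q t ∧
      q ≤ (D + 1 / T) * Q t + (ν / 2 + 144 * T * U ^ 2) * s2 t := by
    intro t htt
    refine ⟨_, hS.dt 0 z t htt, ?_⟩
    have htI := hin t htt
    have cG := GF_cont N m (w t)
    have ct1 := cu t
    have ct2 := cux t
    have ct3 := cE t
    have e1 : (∫ x in (0 : ℝ)..1, 2 * ((∫ y in (0 : ℝ)..x, (u y t - plin N (w t) y))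
          - ∫ x in (0 : ℝ)..1, ∫ y in (0 : ℝ)..x, (u y t - plin N (w t) y))
        * ((∫ y in (0 : ℝ)..x, (ut y t - plin N (w' t) y))
          - ∫ x in (0 : ℝ)..1, ∫ y in (0 : ℝ)..x, (ut y t - plin N (w' t) y)))
        = ∫ x in (0 : ℝ)..1, 2 * E t x *
          (-u x t ^ 2 / 2 + ν * ux x t + pw N (GF N m (w t)) x) := by
      simp only [hr t htt]
      generalize (∫ x in (0 : ℝ)..1, ((-u x t ^ 2 / 2 + ν * ux x t + pw N (GF N m (w t)) x)
        - (-u 0 t ^ 2 / 2 + ν * ux 0 t + pw N (GF N m (w t)) 0))) = c1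
      generalize (-u 0 t ^ 2 / 2 + ν * ux 0 t + pw N (GF N m (w t)) 0) = c2
      have e2 : ∀ x, 2 * ((∫ y in (0 : ℝ)..x, (u y t - plin N (w t) y))
          - ∫ x in (0 : ℝ)..1, ∫ y in (0 : ℝ)..x, (u y t - plin N (w t) y))
        * (-u x t ^ 2 / 2 + ν * ux x t + pw N (GF N m (w t)) x - c2 - c1)
        = 2 * E t x * (-u x t ^ 2 / 2 + ν * ux x t + pw N (GF N m (w t)) x)
          - (2 * (c1 + c2)) * E t x := fun x => by simp only [hE]; ring
      simp only [e2]
      rw [intervalIntegral.integral_sub (Continuous.intervalIntegrable (by fun_prop) _ _)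
        (Continuous.intervalIntegrable (by fun_prop) _ _), intervalIntegral.integral_const_mul,
        hE0, mul_zero, sub_zero]
    have e3 := energy_static N ν m T D hν hT (w t) (fun x => u x t) (fun x => ux x t) (E t)
      ct2 (fun x => hx x t) (hup t) (hEd t) (hEp t htI) (hD t htI)
    have e4 := HF_bound N (w t)
    have e5 := RF_bound N ν m U (w t) (fun i => hwU i t htI)
      (mul_nonneg (by linarith) hN.le) hm3
    refine e1.le.trans (e3.trans ?_)
    have e6 := mul_le_mul_of_nonneg_left e4 (by linarith : 0 ≤ ν / 2)
    have e7 := mul_le_mul_of_nonneg_left e5 hT.le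
    simp only [hs2, hQ]
    nlinarith [e6, e7]
  set K : ℝ := 144 * T * U / N + 1 / (4 * (N : ℝ) ^ 2) with hK
  have hK0 : 0 ≤ K := by positivity
  set W : ℝ → ℝ := fun t => (1 / N) * ∑ i, w t i ^ 2 with hW
  have hW0 : ∀ t, 0 ≤ W t := fun t => by
    simp only [hW]
    have := Finset.sum_nonneg (s := Finset.univ) (fun i (_ : i ∈ Finset.univ) => sq_nonneg (w t i))
    positivity
  have cW : ContinuousOn W (Icc 0 T) := by
    simp only [hW]
    refine continuousOn_const.mul (continuousOn_finsetSum _ fun i _ => (hcw i).pow 2)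
  have hWd : ∀ t ∈ Ioo (0 : ℝ) T, HasDerivAt W (-2 * m * N ^ 2 * s2 t) t := by
    intro t htt
    have a : ∀ i, HasDerivAt (fun s => w s i) (w' t i) t := fun i =>
      (hd i t (hin t htt)).hasDerivAt (Icc_mem_nhds htt.1 htt.2)
    have b := (HasDerivAt.fun_sum (u := Finset.univ)
      (fun i (_ : i ∈ Finset.univ) => (a i).fun_pow 2)).const_mul (1 / (N : ℝ))
    refine b.congr_deriv ?_
    have c := sum_energy N m (w t) (w' t) (hv t (hin t htt))
    have : ∑ i, (((2 : ℕ) : ℝ) * w t i ^ (2 - 1) * w' t i) = 2 * ∑ i, w t i * w' t i := by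
      rw [Finset.mul_sum]
      exact Finset.sum_congr rfl fun i _ => by push_cast; ring
    rw [this, c]
    simp only [hs2]
    ring
  have hKm : 144 * T * U ^ 2 + ν / 2 ≤ K * (2 * m * N ^ 2) := by
    have : K * (2 * m * N ^ 2) = 288 * T * U * (m * N) + m / 2 := by
      simp only [hK]; field_simp; ring
    rw [this]
    have : 0 ≤ T * U := by positivity
    nlinarith
  set Y : ℝ → ℝ := fun t => Real.exp (-(D + 1 / T) * t) * Q t + K * W t with hY
  have hYa : AntitoneOn Y (Icc 0 T) := by
    have hYd : ∀ t ∈ Ioo (0 : ℝ) T, ∃ q, HasDerivAt Y q t ∧ q ≤ 0 := by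
      intro t htt
      obtain ⟨q, hq, hq'⟩ := hQd t htt
      have ex : HasDerivAt (fun t => Real.exp (-(D + 1 / T) * t))
          (Real.exp (-(D + 1 / T) * t) * (-(D + 1 / T))) t := by
        have := ((hasDerivAt_id t).const_mul (-(D + 1 / T))).exp
        simpa using this
      refine ⟨_, (ex.mul hq).add ((hWd t htt).const_mul K), ?_⟩
      have g1 : Real.exp (-(D + 1 / T) * t) ≤ 1 := by
        apply Real.exp_le_one_iff.mpr
        have : 0 ≤ (D + 1 / T) * t := mul_nonneg (by positivity) htt.1.le
        linarith
      have g0 := Real.exp_pos (-(D + 1 / T) * t)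
      generalize Real.exp (-(D + 1 / T) * t) = X at g0 g1 ⊢
      have g2 : X * (-(D + 1 / T)) * Q t + X * q ≤ X * ((ν / 2 + 144 * T * U ^ 2) * s2 t) := by
        nlinarith [mul_le_mul_of_nonneg_left hq' g0.le]
      have g3 : X * ((ν / 2 + 144 * T * U ^ 2) * s2 t) ≤ 1 * ((ν / 2 + 144 * T * U ^ 2) * s2 t) :=
        mul_le_mul_of_nonneg_right g1 (mul_nonneg (by positivity) (hs2n t))
      have g4 := mul_le_mul_of_nonneg_right hKm (hs2n t)
      nlinarith
    refine antitoneOn_of_deriv_nonpos (convex_Icc 0 T) ?_ ?_ ?_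
    · exact ((Continuous.continuousOn (by fun_prop)).mul cQ).add (continuousOn_const.mul cW)
    · rw [interior_Icc]
      intro t htt
      obtain ⟨q, hq, _⟩ := hYd t htt
      exact hq.differentiableAt.differentiableWithinAt
    · rw [interior_Icc]
      intro t htt
      obtain ⟨q, hq, hq'⟩ := hYd t htt
      rw [hq.deriv]; exact hq'
  have fin := hYa ⟨le_rfl, hT.le⟩ ⟨hT.le, le_rfl⟩ hT.le
  simp only [hY, mul_zero, Real.exp_zero, one_mul] at fin
  have := mul_nonneg hK0 (hW0 T)
  linarith


lemma plin_one (N : ℕ) (x : ℝ) : plin N (fun _ => 1) x = 1 := by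
  unfold plin; ring

lemma exp_one_le_three : Real.exp 1 ≤ 3 := by
  have := Real.exp_one_lt_d9
  linarith

/-- the purely algebraic last step -/
lemma final_algebra (h T U D δ L A q : ℝ) (hh : 0 < h) (hT : 0 < T) (hU : 0 ≤ U) (hD : 0 ≤ D)
    (hδ : 0 < δ) (hA : 0 ≤ A) (hR : 0 ≤ L)
    (hq : Real.exp (-(D + 1 / T) * T) * q ≤ h ^ 2 * A + (144 * T * U * h + h ^ 2 / 4) * (3 * A)) :
    Real.sqrt ((1 / δ ^ 2) * q) ≤ 36 * Real.exp (D * T) * Real.sqrt (h / δ ^ 2) *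
      ((Real.sqrt h + Real.sqrt U * Real.sqrt T) * Real.sqrt A + L) := by
  have e1 : Real.exp (-(D + 1 / T) * T) * (Real.exp (D * T) * Real.exp 1) = 1 := by
    rw [← Real.exp_add, ← Real.exp_add, Real.exp_eq_one_iff]
    field_simp; ring
  have hX : 1 ≤ Real.exp (D * T) := Real.one_le_exp (by positivity)
  have h3 := exp_one_le_three
  have hp := Real.exp_pos 1
  set X := Real.exp (D * T) with hXd
  have hTU : 0 ≤ T * U := by positivity
  have q1 : q ≤ X ^ 2 * (1296 * h * (h + T * U) * A) := by
    have a1 := mul_le_mul_of_nonneg_right hq (by positivity : 0 ≤ X * Real.exp 1)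
    have a2 : Real.exp (-(D + 1 / T) * T) * q * (X * Real.exp 1) = q := by
      rw [mul_right_comm, e1, one_mul]
    rw [a2] at a1
    have a3 : h ^ 2 * A + (144 * T * U * h + h ^ 2 / 4) * (3 * A) ≤ 432 * h * (h + T * U) * A := by
      have : 0 ≤ h ^ 2 * A := by positivity
      nlinarith
    have a4 : X * Real.exp 1 ≤ X ^ 2 * 3 := by nlinarith
    have a5 : 0 ≤ 432 * h * (h + T * U) * A := by positivity
    calc q ≤ _ := a1
      _ ≤ 432 * h * (h + T * U) * A * (X * Real.exp 1) :=
        mul_le_mul_of_nonneg_right a3 (by positivity)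
      _ ≤ 432 * h * (h + T * U) * A * (X ^ 2 * 3) := mul_le_mul_of_nonneg_left a4 a5
      _ = _ := by ring
  have s1 : h + T * U ≤ (Real.sqrt h + Real.sqrt U * Real.sqrt T) ^ 2 := by
    have b1 := Real.sq_sqrt hh.le
    have b2 := Real.sq_sqrt hU
    have b3 := Real.sq_sqrt hT.le
    have : 0 ≤ Real.sqrt h * (Real.sqrt U * Real.sqrt T) := by positivity
    have b4 : (Real.sqrt U * Real.sqrt T) ^ 2 = T * U := by rw [mul_pow, b2, b3]; ring
    nlinarith
  have s2 : Real.sqrt ((1 / δ ^ 2) * q) ≤ 36 * X * Real.sqrt (h / δ ^ 2) *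
      ((Real.sqrt h + Real.sqrt U * Real.sqrt T) * Real.sqrt A) := by
    apply Real.sqrt_le_iff.mpr
    refine ⟨by positivity, ?_⟩
    have c1 : (36 * X * Real.sqrt (h / δ ^ 2) *
      ((Real.sqrt h + Real.sqrt U * Real.sqrt T) * Real.sqrt A)) ^ 2
      = 1296 * X ^ 2 * (h / δ ^ 2) * ((Real.sqrt h + Real.sqrt U * Real.sqrt T) ^ 2 * A) := by
      simp only [mul_pow]
      rw [Real.sq_sqrt (by positivity : 0 ≤ h / δ ^ 2), Real.sq_sqrt hA]
      ring
    rw [c1]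
    calc (1 / δ ^ 2) * q ≤ (1 / δ ^ 2) * (X ^ 2 * (1296 * h * (h + T * U) * A)) :=
          mul_le_mul_of_nonneg_left q1 (by positivity)
      _ = (1296 * X ^ 2 * (h / δ ^ 2) * A) * (h + T * U) := by ring
      _ ≤ (1296 * X ^ 2 * (h / δ ^ 2) * A) * (Real.sqrt h + Real.sqrt U * Real.sqrt T) ^ 2 :=
          mul_le_mul_of_nonneg_left s1 (by positivity)
      _ = _ := by ring
  refine s2.trans (mul_le_mul_of_nonneg_left ?_ (by positivity))
  linarith

lemma deriv_bound (u₀ : ℝ → ℝ) (hs : ContDiff ℝ (⊤ : ℕ∞) u₀) (hp : ∀ x, u₀ (x + 1) = u₀ x) :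
    0 ≤ sSup (deriv u₀ '' Icc (0 : ℝ) 1) ∧ ∀ x, deriv u₀ x ≤ sSup (deriv u₀ '' Icc (0 : ℝ) 1) := by
  have cd : Continuous (deriv u₀) := hs.continuous_deriv (by exact_mod_cast le_top)
  have hb : BddAbove (deriv u₀ '' Icc (0 : ℝ) 1) := (isCompact_Icc.image cd).bddAbove
  have hI : ∀ x ∈ Icc (0 : ℝ) 1, deriv u₀ x ≤ sSup (deriv u₀ '' Icc (0 : ℝ) 1) := fun x hx =>
    le_csSup hb ⟨x, hx, rfl⟩
  have hper : Function.Periodic (deriv u₀) 1 := by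
    intro x
    rw [← deriv_comp_add_const]
    simp only [hp]
  constructor
  · obtain ⟨c, hc, hc'⟩ := exists_deriv_eq_zero (f := u₀) zero_lt_one hs.continuous.continuousOn
      (by simpa using (hp 0).symm)
    exact hc'.symm.le.trans (hI c ⟨hc.1.le, hc.2.le⟩)
  · intro x
    have := hper.sub_zsmul_eq (x := x) ⌊x⌋
    rw [← this]
    apply hI
    simp only [zsmul_eq_mul, mul_one]
    exact ⟨Int.fract_nonneg x, (Int.fract_lt_one x).le⟩


/-- **A priori error estimate for filtered quantities** (Theorem 5.1, second
part): the `δ`-filtered error `⟦ẽ⟧_δ` of the stabilized finite element solution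
of the Burgers equation satisfies
`⟦ẽ⟧_δ ≤ C exp(D₀T) (h/δ²)^{1/2} ((h^{1/2} + U₀^{1/2}T^{1/2})‖u₀‖ +
(TU₀ + h^{1/2}ν^{1/2})‖u₀'‖)`, with `C` independent of `N`, `h`, `ν`, `δ`, `T`
and the data; in particular the bound is independent of the regularity of the
exact solution and of the Reynolds number. -/
theorem apriori_error_estimate_filtered :
    ∃ C : ℝ, 0 < C ∧
      ∀ (N : ℕ) [NeZero N], 3 ≤ N →
      ∀ T ν : ℝ, 0 < T → 0 ≤ ν →
      -- smooth 1-periodic initial data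
      ∀ u₀ : ℝ → ℝ, ContDiff ℝ (⊤ : ℕ∞) u₀ → (∀ x, u₀ (x + 1) = u₀ x) →
      -- u : smooth 1-periodic solution of the Burgers equation
      ∀ u ux uxx ut : ℝ → ℝ → ℝ,
      (∀ x t, u (x + 1) t = u x t) →
      (Continuous fun p : ℝ × ℝ => u p.1 p.2) →
      (Continuous fun p : ℝ × ℝ => ux p.1 p.2) →
      (Continuous fun p : ℝ × ℝ => uxx p.1 p.2) →
      (Continuous fun p : ℝ × ℝ => ut p.1 p.2) →
      (∀ x t, HasDerivAt (fun y => u y t) (ux x t) x) →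
      (∀ x t, HasDerivAt (fun y => ux y t) (uxx x t) x) →
      (∀ x, ∀ t ∈ Icc (0 : ℝ) T,
        HasDerivWithinAt (fun s => u x s) (ut x t) (Icc (0 : ℝ) T) t) →
      (∀ x, ∀ t ∈ Ioc (0 : ℝ) T,
        ut x t + u x t * ux x t - ν * uxx x t = 0) →
      (∀ x, u x 0 = u₀ x) →
      -- u_h : mass-lumped Galerkin scheme with linear artificial viscosity
      ∀ w w' : ℝ → ZMod N → ℝ, ∀ h : ℝ, h = 1 / N →
      ∀ d : ℝ → ZMod N → ℝ, (∀ t i, d t i = (w t (i + 1) - w t i) / h) →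
      ∀ U₀ : ℝ,
        U₀ = (Finset.univ.sup' ⟨(0 : ZMod N), Finset.mem_univ _⟩
          fun j => |w 0 j|) →
      ∀ νhat : ℝ, νhat = max (U₀ * h / 2) ν →
      (∀ i, ∀ t ∈ Icc (0 : ℝ) T,
        HasDerivWithinAt (fun s => w s i) (w' t i) (Icc (0 : ℝ) T) t) →
      (∀ i, ∀ t ∈ Icc (0 : ℝ) T,
        h * w' t i
          = -(1 / 6) * (w t (i + 1) ^ 2 + w t i * w t (i + 1)
              - w t i * w t (i - 1) - w t (i - 1) ^ 2)
            + νhat * d t i - νhat * d t (i - 1)) →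
      -- initial data : u_h(·,0) = π_h u₀  (L²-orthogonality of the residual)
      (∀ v : ZMod N → ℝ,
        (∫ x in (0 : ℝ)..1, (u₀ x - plin N (w 0) x) * plin N v x) = 0) →
      -- D₀ := (1/2)(sup u₀' + maxᵢ dᵢ(0)) ≥ 0
      ∀ D₀ : ℝ,
        D₀ = (1 / 2) * (sSup (deriv u₀ '' Icc (0 : ℝ) 1)
          + Finset.univ.sup' ⟨(0 : ZMod N), Finset.mem_univ _⟩ fun i => d 0 i) →
        0 ≤ D₀ →
      -- the differential filters of u(·,T) and u_h(·,T), of width δ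
      ∀ δ : ℝ, 0 < δ →
      ∀ utilde uhtilde : ℝ → ℝ,
      ContDiff ℝ 2 utilde → (∀ x, utilde (x + 1) = utilde x) →
      (∀ x, -δ ^ 2 * iteratedDeriv 2 utilde x + utilde x = u x T) →
      ContDiff ℝ 2 uhtilde → (∀ x, uhtilde (x + 1) = uhtilde x) →
      (∀ x, -δ ^ 2 * iteratedDeriv 2 uhtilde x + uhtilde x = plin N (w T) x) →
      -- a smooth solution φ of the dual adjoint problem with coefficient
      -- a := (u + u_h)/2 and terminal data ẽ := ũ − ũ_h
      ∀ φ φx φxx φt : ℝ → ℝ → ℝ,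
      (∀ x t, φ (x + 1) t = φ x t) →
      (Continuous fun p : ℝ × ℝ => φ p.1 p.2) →
      (Continuous fun p : ℝ × ℝ => φx p.1 p.2) →
      (Continuous fun p : ℝ × ℝ => φxx p.1 p.2) →
      (Continuous fun p : ℝ × ℝ => φt p.1 p.2) →
      (∀ x t, HasDerivAt (fun y => φ y t) (φx x t) x) →
      (∀ x t, HasDerivAt (fun y => φx y t) (φxx x t) x) →
      (∀ x, ∀ t ∈ Icc (0 : ℝ) T,
        HasDerivWithinAt (fun s => φ x s) (φt x t) (Icc (0 : ℝ) T) t) →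
      (∀ x, ∀ t ∈ Ioo (0 : ℝ) T,
        -φt x t + ((u x t + plin N (w t) x) / 2) * φx x t - ν * φxx x t = 0) →
      (∀ x, φ x T = utilde x - uhtilde x) →
      -- a priori error estimate for the filtered error
      Real.sqrt (δ ^ 2 * (∫ x in (0 : ℝ)..1,
              (deriv (fun y => utilde y - uhtilde y) x) ^ 2)
            + ∫ x in (0 : ℝ)..1, (utilde x - uhtilde x) ^ 2)
        ≤ C * Real.exp (D₀ * T) * Real.sqrt (h / δ ^ 2) *
            ((Real.sqrt h + Real.sqrt U₀ * Real.sqrt T)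
                * Real.sqrt (∫ x in (0 : ℝ)..1, u₀ x ^ 2)
              + (T * U₀ + Real.sqrt h * Real.sqrt ν)
                * Real.sqrt (∫ x in (0 : ℝ)..1, deriv u₀ x ^ 2)) := by
  refine ⟨36, by norm_num, ?_⟩
  intro N _ hN3 T ν hT hν u₀ hu₀ hu₀p u ux uxx ut hper hcu hcux hcuxx hcut hx hxx ht hpde hu0
    w w' h hh d hdd U₀ hU₀ νhat hνhat hd hode horth D₀ hD₀ hD₀n δ hδ utilde uhtilde
    hut hutp hutf huh huhp huhf _ _ _ _ _ _ _ _ _ _ _ _ _ _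
  have hN : (0 : ℝ) < N := by exact_mod_cast Nat.pos_of_ne_zero (NeZero.ne N)
  have hhp : 0 < h := by rw [hh]; positivity
  have hhN : h * N = 1 := by rw [hh]; field_simp
  have hU0 : ∀ i, |w 0 i| ≤ U₀ := fun i => by
    rw [hU₀]; exact Finset.le_sup' (fun j => |w 0 j|) (Finset.mem_univ i)
  have hUn : 0 ≤ U₀ := (abs_nonneg _).trans (hU0 0)
  have hd' : ∀ t i, d t i = N * (w t (i + 1) - w t i) := fun t i => by
    rw [hdd, hh]; field_simp
  have hode' : ∀ i, ∀ t ∈ Icc (0 : ℝ) T, w' t i = N * (-(1 / 6) * (w t (i + 1) ^ 2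
      + w t i * w t (i + 1) - w t i * w t (i - 1) - w t (i - 1) ^ 2)
      + (νhat * N) * (w t (i + 1) - 2 * w t i + w t (i - 1))) := by
    intro i t htt
    have a := hode i t htt
    rw [hd', hd', sub_add_cancel] at a
    have b : w' t i = N * (h * w' t i) := by rw [← mul_assoc, mul_comm (N : ℝ) h, hhN, one_mul]
    rw [b, a]; ring
  have m1 : U₀ * h / 2 ≤ νhat := hνhat ▸ le_max_left _ _
  have m2 : ν ≤ νhat := hνhat ▸ le_max_right _ _
  have hm1 : U₀ / 2 ≤ νhat * N := by
    have := mul_le_mul_of_nonneg_right m1 hN.le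
    have e : U₀ * h / 2 * N = U₀ / 2 := by
      rw [show U₀ * h / 2 * N = U₀ * (h * N) / 2 by ring, hhN, mul_one]
    linarith
  have hm3 : (νhat - ν) * N ≤ U₀ / 2 := by
    have e : U₀ * h / 2 * N = U₀ / 2 := by
      rw [show U₀ * h / 2 * N = U₀ * (h * N) / 2 by ring, hhN, mul_one]
    rw [← e]
    refine mul_le_mul_of_nonneg_right ?_ hN.le
    have : 0 ≤ U₀ * h / 2 := by positivity
    rw [hνhat, sub_le_iff_le_add]
    exact max_le (by linarith) (by linarith)
  have hwU := w_bound N T U₀ (νhat * N) w w' hU0 hm1 hd hode'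
  obtain ⟨hM0, hM⟩ := deriv_bound u₀ hu₀ hu₀p
  have hux0 : ∀ x, ux x 0 ≤ sSup (deriv u₀ '' Icc (0 : ℝ) 1) := by
    intro x
    have a := (hx x 0).deriv
    simp only [hu0] at a
    rw [← a]; exact hM x
  have hux := ux_bound T ν _ hν hM0 u ux uxx ut hper hcu hx hxx ht hpde hux0
  have hdb := d_bound N T U₀ (νhat * N)
    (Finset.univ.sup' ⟨(0 : ZMod N), Finset.mem_univ _⟩ fun i => d 0 i) w w' hwU hm1
    (fun i => by rw [← hd']; exact Finset.le_sup' (fun i => d 0 i) (Finset.mem_univ i)) hd hode'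
  have hD : ∀ t ∈ Icc (0 : ℝ) T, ∀ x i, (ux x t + N * (w t (i + 1) - w t i)) / 2 ≤ D₀ := by
    intro t htt x i
    have a := hux x t htt
    have b := hdb i t htt
    rw [hD₀]; linarith
  have hv : ∀ t ∈ Icc (0 : ℝ) T, ∀ i,
      w' t i = -N * (GN N νhat (w t) i - GN N νhat (w t) (i - 1)) := by
    intro t htt i
    rw [hode' i t htt]
    unfold GN
    rw [sub_add_cancel]
    ring
  have h0 : ∫ x in (0 : ℝ)..1, (u x 0 - plin N (w 0) x) = 0 := by
    have := horth (fun _ => 1)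
    simpa only [plin_one, mul_one, hu0] using this
  obtain ⟨E, hE, hE0, hEp, hQ⟩ := energy_decay N T ν νhat U₀ D₀ hT hν u ux uxx ut w w' hper hcu
    hcut hx hxx ht hpde hd hm1 m2 hm3 hwU hD hD₀n hv h0
  -- initial data
  have cu0 : Continuous u₀ := hu₀.continuous
  have cp0 := plin_continuous N (w 0)
  set A : ℝ := ∫ x in (0 : ℝ)..1, u₀ x ^ 2 with hA
  have hAn : 0 ≤ A := intervalIntegral.integral_nonneg zero_le_one fun x _ => sq_nonneg _
  have pyth : (∫ x in (0 : ℝ)..1, plin N (w 0) x ^ 2)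
      + (∫ x in (0 : ℝ)..1, (u₀ x - plin N (w 0) x) ^ 2) = A := by
    have a := horth (w 0)
    have b : (∫ x in (0 : ℝ)..1, plin N (w 0) x ^ 2)
      + (∫ x in (0 : ℝ)..1, (u₀ x - plin N (w 0) x) ^ 2)
      + 2 * (∫ x in (0 : ℝ)..1, (u₀ x - plin N (w 0) x) * plin N (w 0) x) = A := by
      rw [← intervalIntegral.integral_const_mul,
        ← intervalIntegral.integral_add (Continuous.intervalIntegrable (by fun_prop) _ _)
          (Continuous.intervalIntegrable (by fun_prop) _ _),
        ← intervalIntegral.integral_add (Continuous.intervalIntegrable (by fun_prop) _ _)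
          (Continuous.intervalIntegrable (by fun_prop) _ _)]
      refine intervalIntegral.integral_congr fun x _ => ?_
      ring
    rw [a] at b; linarith
  have p1 : 0 ≤ ∫ x in (0 : ℝ)..1, plin N (w 0) x ^ 2 :=
    intervalIntegral.integral_nonneg zero_le_one fun x _ => sq_nonneg _
  have p2 : 0 ≤ ∫ x in (0 : ℝ)..1, (u₀ x - plin N (w 0) x) ^ 2 :=
    intervalIntegral.integral_nonneg zero_le_one fun x _ => sq_nonneg _
  have i1 := init_est N (fun x => u₀ x - plin N (w 0) x) (E 0) (cu0.sub cp0)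
    (fun x => by rw [← hu0]; exact hE 0 x) (hE0 0) horth
  have i2 := lumped_norm N (w 0)
  have hN2 : 1 / (N : ℝ) ^ 2 = h ^ 2 := by rw [hh]; field_simp
  rw [hN2] at i1
  have hKe : 144 * T * U₀ / N + 1 / (4 * (N : ℝ) ^ 2) = 144 * T * U₀ * h + h ^ 2 / 4 := by
    rw [hh]; field_simp
  rw [hKe] at hQ
  have hfin : Real.exp (-(D₀ + 1 / T) * T) * (∫ x in (0 : ℝ)..1, E T x ^ 2) ≤
      h ^ 2 * A + (144 * T * U₀ * h + h ^ 2 / 4) * (3 * A) := by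
    refine hQ.trans (add_le_add (i1.trans ?_) ?_)
    · exact mul_le_mul_of_nonneg_left (by linarith) (by positivity)
    · exact mul_le_mul_of_nonneg_left (by linarith) (by positivity)
  -- the filter
  have hfl := filter_est δ hδ (fun x => u x T - plin N (w T) x) (E T)
    (fun y => utilde y - uhtilde y) (hE T) (hEp T ⟨hT.le, le_rfl⟩) (hut.sub huh)
    (fun x => by simp only [hutp, huhp])
    (fun x => by
      have a : iteratedDeriv 2 (fun y => utilde y - uhtilde y) x
          = iteratedDeriv 2 utilde x - iteratedDeriv 2 uhtilde x :=
        iteratedDeriv_fun_sub hut.contDiffAt huh.contDiffAt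
      rw [a, ← hutf, ← huhf]; ring)
  refine (Real.sqrt_le_sqrt hfl).trans ?_
  exact final_algebra h T U₀ D₀ δ _ A _ hhp hT hUn hD₀n hδ hAn (by positivity) hfin
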